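/- Let n ≥ 2, let w₁, …, w_n be real numbers, let δ ∈ (0,1), let μ > 0, and let α be a real number with α ≥ (1 + 2δ/(1−δ))·μ. Suppose that for every i ∈ {1,…,n} one has (1−δ)(n−1) ≤ Σ_{j≠i} w_j² ≤ (1+δ)(n−1) and Σ_{j≠i} |w_j|³ ≤ (1+δ)·μ·(n−1), and suppose there are at least m indices i ∈ {1,…,n} with |w_i| ≥ α. Then the homogeneous linear threshold function f(x) = sign(Σ_{j=1}^n w_j x_j) satisfies Inf(f) ≥ m·[ (α − (1 + 2δ/(1−δ))·μ)/√(2π(1+δ)(n−1)) − α³/(6√(2π)·((1−δ)(n−1))^{3/2}) − 3.4106·((1+δ)μ)^{4/3}/((1−δ)²·(n−1)^{2/3}) ]. -/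

import Mathlib

open Finset Real MeasureTheory ProbabilityTheory
open scoped Classical

/-- sign: maps z to 1 if z > 0 and to −1 if z ≤ 0. -/
noncomputable def sgn (z : ℝ) : ℝ := if 0 < z then 1 else -1

/-- interpret a Bool as ±1. -/
def pm (b : Bool) : ℝ := if b then 1 else -1

/-- probability of an event under the uniform distribution on {−1,1}^n. -/
noncomputable def unifPr (n : ℕ) (E : (Fin n → Bool) → Prop) : ℝ :=
  ((Finset.univ : Finset (Fin n → Bool)).filter E).card / 2 ^ n

/-- expectation under the uniform distribution on {−1,1}^n. -/
noncomputable def unifExp (n : ℕ) (g : (Fin n → Bool) → ℝ) : ℝ :=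
  (∑ x : Fin n → Bool, g x) / 2 ^ n

/-- flip the i-th coordinate. -/
def flipAt {n : ℕ} (i : Fin n) (x : Fin n → Bool) : Fin n → Bool :=
  Function.update x i (!(x i))

/-- influence of coordinate i. -/
noncomputable def infl {n : ℕ} (f : (Fin n → Bool) → ℝ) (i : Fin n) : ℝ :=
  unifPr n (fun x => f x ≠ f (flipAt i x))

/-- total influence. -/
noncomputable def totalInfl {n : ℕ} (f : (Fin n → Bool) → ℝ) : ℝ :=
  ∑ i, infl f i

/-- Fourier coefficient f̂(S). -/
noncomputable def fCoeff {n : ℕ} (f : (Fin n → Bool) → ℝ) (S : Finset (Fin n)) : ℝ :=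
  unifExp n (fun x => f x * ∏ i ∈ S, pm (x i))

/-- Fourier entropy with log base 2 (0 · log(1/0) is 0 by convention, which holds
definitionally since `Real.log 0 = 0` in Mathlib). -/
noncomputable def fourierEntropy {n : ℕ} (f : (Fin n → Bool) → ℝ) : ℝ :=
  ∑ S : Finset (Fin n), (fCoeff f S) ^ 2 * Real.logb 2 (1 / (fCoeff f S) ^ 2)

/-- The linear threshold function with weights w₀, w₁, …, w_n. -/
noncomputable def ltf (n : ℕ) (w : Fin (n + 1) → ℝ) : (Fin n → Bool) → ℝ :=
  fun x => sgn (w 0 + ∑ i : Fin n, w i.succ * pm (x i))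


lemma aux_sin_lower {x : ℝ} (hx : 0 ≤ x) : x - x ^ 2 / π ≤ sin x := by
  have hpi := Real.pi_pos
  have h3 := Real.pi_gt_three
  have h4 := Real.pi_lt_d2
  have key : ∀ y : ℝ, 0 ≤ y → y ≤ π / 2 → y - y ^ 2 / π ≤ sin y := by
    intro y hy hy2
    have h := Real.sin_ge_sub_cube hy
    have : y ^ 3 / 6 ≤ y ^ 2 / π := by
      rw [div_le_div_iff₀ (by norm_num) hpi]
      have : y * π ≤ 6 := by nlinarith
      nlinarith [mul_le_mul_of_nonneg_left this (sq_nonneg y)]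
    linarith
  rcases le_or_gt x (π / 2) with h | h
  · exact key x hx h
  rcases le_or_gt x π with h' | h'
  · have := key (π - x) (by linarith) (by linarith)
    rw [Real.sin_pi_sub] at this
    have e : (π - x) - (π - x) ^ 2 / π = x - x ^ 2 / π := by field_simp; ring
    linarith
  · have h5 : sin x = - sin (x - π) := by rw [Real.sin_sub_pi]; ring
    have h6 := Real.sin_le (x := x - π) (by linarith)
    have e : x - x ^ 2 / π = - (x * (x - π) / π) := by field_simp; ring
    have : x - π ≤ x * (x - π) / π := by
      rw [le_div_iff₀ hpi]; nlinarith
    rw [h5, e]; linarith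

lemma aux_cos_lower {x : ℝ} (hx : |x| ≤ π / 2) :
    exp (-(x ^ 2 / 2)) * (1 - x ^ 4 / 4) ≤ cos x := by
  have hc : 0 ≤ cos x := Real.cos_nonneg_of_mem_Icc ⟨by linarith [(abs_le.1 hx).1], (abs_le.1 hx).2⟩
  set z := x ^ 2 / 2 with hz
  have hz0 : 0 ≤ z := by positivity
  have e : x ^ 4 / 4 = z ^ 2 := by rw [hz]; ring
  rw [e]
  rcases le_or_gt 1 z with h | h
  · have : 1 - z ^ 2 ≤ 0 := by nlinarith
    exact le_trans (mul_nonpos_of_nonneg_of_nonpos (exp_pos _).le this) hc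
  · have h1 : 1 - z ≤ cos x := by rw [hz]; exact Real.one_sub_sq_div_two_le_cos
    have h2 : exp (-z) * (1 + z) ≤ 1 := by
      have := Real.add_one_le_exp z
      rw [Real.exp_neg, inv_mul_le_iff₀ (exp_pos _)]; linarith
    calc exp (-z) * (1 - z ^ 2) = (exp (-z) * (1 + z)) * (1 - z) := by ring
      _ ≤ 1 * (1 - z) := mul_le_mul_of_nonneg_right h2 (by linarith)
      _ ≤ cos x := by linarith

lemma aux_cos_upper {x : ℝ} (hx : |x| ≤ π / 2) : cos x ≤ exp (-(x ^ 2 / 2)) := by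
  wlog h0 : 0 ≤ x generalizing x
  · have := this (x := -x) (by simpa using hx) (by linarith)
    simpa using this
  rw [abs_of_nonneg h0] at hx
  have anti : AntitoneOn (fun x : ℝ => cos x * exp (x ^ 2 / 2)) (Set.Icc 0 (π / 2)) := by
    apply antitoneOn_of_deriv_nonpos (convex_Icc _ _)
    · fun_prop
    · fun_prop
    · intro y hy
      rw [interior_Icc] at hy
      have hd : HasDerivAt (fun x : ℝ => cos x * exp (x ^ 2 / 2))
          (-sin y * exp (y ^ 2 / 2) + cos y * (exp (y ^ 2 / 2) * (2 * y / 2))) y := by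
        have h1 := (((hasDerivAt_pow 2 y).div_const 2).exp)
        have h2 := (Real.hasDerivAt_cos y).mul h1
        exact h2.congr_deriv (by norm_num)
      rw [hd.deriv]
      have hy1 := hy.1
      have hc : 0 < cos y := Real.cos_pos_of_mem_Ioo ⟨by linarith [Real.pi_pos], hy.2⟩
      have ht := Real.lt_tan hy.1 hy.2
      rw [Real.tan_eq_sin_div_cos, lt_div_iff₀ hc] at ht
      have := exp_pos (y ^ 2 / 2)
      nlinarith
  have := anti (a := 0) (b := x) ⟨le_rfl, by linarith [Real.pi_pos]⟩ ⟨h0, hx⟩ h0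
  simp only [cos_zero] at this
  norm_num at this
  rw [Real.exp_neg, ← one_div, le_div_iff₀ (exp_pos _)]
  exact this

lemma aux_cos_abs (x : ℝ) :
    |cos x| ≤ exp (-(x ^ 2 * (max (1 - |x| / π) 0) ^ 2 / 2)) := by
  have hs : x ^ 2 * (max (1 - |x| / π) 0) ^ 2 ≤ sin x ^ 2 := by
    rcases le_or_gt (|x| / π) 1 with h | h
    · rw [max_eq_left (by linarith)]
      have h1 := aux_sin_lower (abs_nonneg x)
      have h2 : 0 ≤ |x| * (1 - |x| / π) := mul_nonneg (abs_nonneg _) (by linarith)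
      have h3 : |x| * (1 - |x| / π) ≤ sin |x| := by
        refine le_trans (le_of_eq ?_) h1; ring
      have h4 : sin |x| ^ 2 = sin x ^ 2 := by
        rcases abs_choice x with h | h <;> rw [h]; simp
      rw [← h4, ← sq_abs x, ← mul_pow]
      exact pow_le_pow_left₀ h2 h3 2
    · rw [max_eq_right (by linarith)]; simp; positivity
  have h1 : cos x ^ 2 ≤ exp (-(x ^ 2 * (max (1 - |x| / π) 0) ^ 2)) := by
    have := Real.add_one_le_exp (-(x ^ 2 * (max (1 - |x| / π) 0) ^ 2))
    nlinarith [Real.sin_sq_add_cos_sq x]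
  refine abs_le_of_sq_le_sq ?_ (exp_pos _).le
  rw [← Real.exp_nat_mul]
  refine h1.trans (le_of_eq ?_)
  congr 1; push_cast; ring


lemma aux_prod_lower {ι : Type*} (s : Finset ι) (e : ι → ℝ) (h0 : ∀ i ∈ s, 0 ≤ e i)
    (h1 : ∀ i ∈ s, e i ≤ 1) : 1 - ∑ i ∈ s, (1 - e i) ≤ ∏ i ∈ s, e i ∧ ∏ i ∈ s, e i ≤ 1 := by
  refine ⟨?_, Finset.prod_le_one h0 h1⟩
  induction s using Finset.induction_on with
  | empty => simp
  | insert a s ha ih =>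
    rw [Finset.sum_insert ha, Finset.prod_insert ha]
    have ih' := ih (fun i hi => h0 i (mem_insert_of_mem hi)) (fun i hi => h1 i (mem_insert_of_mem hi))
    have hp : ∏ i ∈ s, e i ≤ 1 := Finset.prod_le_one (fun i hi => h0 i (mem_insert_of_mem hi)) (fun i hi => h1 i (mem_insert_of_mem hi))
    have a1 := h1 a (mem_insert_self _ _)
    have a0 := h0 a (mem_insert_self _ _)
    nlinarith

lemma aux_max_le {n : ℕ} {u : Fin n → ℝ} {b : ℝ} (hb : 0 < b) (h3 : ∑ j, |u j| ^ 3 ≤ b ^ 3) (j : Fin n) :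
    |u j| ≤ b := by
  have : |u j| ^ 3 ≤ b ^ 3 := le_trans
    (Finset.single_le_sum (f := fun j => |u j| ^ 3) (fun i _ => by positivity) (mem_univ j)) h3
  exact le_of_pow_le_pow_left₀ (by norm_num) hb.le this

lemma aux_sum4 {n : ℕ} {u : Fin n → ℝ} {b : ℝ} (hb : 0 < b) (h3 : ∑ j, |u j| ^ 3 ≤ b ^ 3) :
    ∑ j, u j ^ 4 ≤ b ^ 4 := by
  calc ∑ j, u j ^ 4 ≤ ∑ j, b * |u j| ^ 3 := by
        apply Finset.sum_le_sum
        intro j _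
        have := aux_max_le hb h3 j
        have e : u j ^ 4 = |u j| * |u j| ^ 3 := by
          rw [← pow_succ', Even.pow_abs (by decide)]
        rw [e]
        exact mul_le_mul_of_nonneg_right this (by positivity)
    _ = b * ∑ j, |u j| ^ 3 := by rw [Finset.mul_sum]
    _ ≤ b * b ^ 3 := by gcongr
    _ = b ^ 4 := by ring

/-- near the origin the characteristic function is close to the Gaussian one -/
lemma aux_phi_near {n : ℕ} {u : Fin n → ℝ} {b : ℝ} (hb : 0 < b) (h2 : ∑ j, u j ^ 2 = 1)
    (h3 : ∑ j, |u j| ^ 3 ≤ b ^ 3) {t : ℝ} (ht0 : 0 ≤ t) (ht : t ≤ π / (2 * b)) :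
    |∏ j, cos (u j * t) - exp (-(t ^ 2 / 2))| ≤ b ^ 4 * t ^ 4 / 4 * exp (-(t ^ 2 / 2)) := by
  have hx : ∀ j, |u j * t| ≤ π / 2 := by
    intro j
    rw [abs_mul, abs_of_nonneg ht0]
    have := aux_max_le hb h3 j
    calc |u j| * t ≤ b * (π / (2 * b)) := mul_le_mul this ht ht0 hb.le
      _ = π / 2 := by field_simp
  set e : Fin n → ℝ := fun j => cos (u j * t) * exp ((u j * t) ^ 2 / 2) with he
  have e0 : ∀ j ∈ (univ : Finset (Fin n)), 0 ≤ e j := fun j _ => mul_nonneg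
    (Real.cos_nonneg_of_mem_Icc ⟨by linarith [(abs_le.1 (hx j)).1], (abs_le.1 (hx j)).2⟩) (exp_pos _).le
  have e1 : ∀ j ∈ (univ : Finset (Fin n)), e j ≤ 1 := fun j _ => by
    have := mul_le_mul_of_nonneg_right (aux_cos_upper (hx j)) (exp_pos ((u j * t) ^ 2 / 2)).le
    rwa [← Real.exp_add, neg_add_cancel, Real.exp_zero] at this
  have e2 : ∀ j, 1 - e j ≤ u j ^ 4 * (t ^ 4 / 4) := fun j => by
    have := mul_le_mul_of_nonneg_right (aux_cos_lower (hx j)) (exp_pos ((u j * t) ^ 2 / 2)).le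
    rw [mul_right_comm, ← Real.exp_add, neg_add_cancel, Real.exp_zero] at this
    have h : (u j * t) ^ 4 / 4 = u j ^ 4 * (t ^ 4 / 4) := by ring
    simp only [he]
    linarith
  obtain ⟨hl, hu⟩ := aux_prod_lower univ e e0 e1
  have hs : ∑ j, (1 - e j) ≤ b ^ 4 * t ^ 4 / 4 := by
    calc ∑ j, (1 - e j) ≤ ∑ j, u j ^ 4 * (t ^ 4 / 4) := Finset.sum_le_sum fun j _ => e2 j
      _ = (∑ j, u j ^ 4) * (t ^ 4 / 4) := by rw [Finset.sum_mul]
      _ ≤ b ^ 4 * (t ^ 4 / 4) := by gcongr; exact aux_sum4 hb h3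
      _ = _ := by ring
  have hp : ∏ j, cos (u j * t) = (∏ j, e j) * exp (-(t ^ 2 / 2)) := by
    simp only [he]
    rw [Finset.prod_mul_distrib, ← Real.exp_sum, mul_assoc, ← Real.exp_add]
    have : ∑ j, (u j * t) ^ 2 / 2 = t ^ 2 / 2 := by
      rw [← Finset.sum_div]; simp_rw [mul_pow]; rw [← Finset.sum_mul, h2, one_mul]
    rw [this]; simp
  rw [hp]
  have hE := exp_pos (-(t ^ 2 / 2))
  rw [abs_le]
  constructor <;> nlinarith

/-- global decay of the characteristic function -/
lemma aux_phi_far {n : ℕ} {u : Fin n → ℝ} {b : ℝ} (h2 : ∑ j, u j ^ 2 = 1)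
    (h3 : ∑ j, |u j| ^ 3 ≤ b ^ 3) {t : ℝ} (ht0 : 0 ≤ t) (ht : b ^ 3 * t / π ≤ 1) :
    |∏ j, cos (u j * t)| ≤ exp (-((t * (1 - b ^ 3 * t / π)) ^ 2 / 2)) := by
  have hpi := Real.pi_pos
  set q : Fin n → ℝ := fun j => max (1 - |u j * t| / π) 0 with hq
  have hcs : (∑ j, u j ^ 2 * q j) ^ 2 ≤ ∑ j, u j ^ 2 * q j ^ 2 := by
    have := Finset.sum_mul_sq_le_sq_mul_sq univ (fun j => u j) (fun j => u j * q j)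
    rw [h2, one_mul] at this
    calc (∑ j, u j ^ 2 * q j) ^ 2 = (∑ j, u j * (u j * q j)) ^ 2 := by
          congr 1; apply Finset.sum_congr rfl; intros; ring
      _ ≤ _ := this
      _ = _ := by apply Finset.sum_congr rfl; intros; ring
  have hlow : 1 - b ^ 3 * t / π ≤ ∑ j, u j ^ 2 * q j := by
    calc 1 - b ^ 3 * t / π ≤ 1 - (∑ j, |u j| ^ 3) * t / π := by gcongr
      _ = ∑ j, (u j ^ 2 - |u j| ^ 3 * t / π) := by
          rw [Finset.sum_sub_distrib, h2, Finset.sum_mul, Finset.sum_div]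
      _ ≤ ∑ j, u j ^ 2 * q j := by
          apply Finset.sum_le_sum
          intro j _
          have : u j ^ 2 * (1 - |u j * t| / π) ≤ u j ^ 2 * q j :=
            mul_le_mul_of_nonneg_left (le_max_left _ _) (sq_nonneg _)
          refine le_trans (le_of_eq ?_) this
          rw [abs_mul, abs_of_nonneg ht0, ← sq_abs]; ring
  have hsq : (1 - b ^ 3 * t / π) ^ 2 ≤ ∑ j, u j ^ 2 * q j ^ 2 :=
    le_trans (pow_le_pow_left₀ (by linarith) hlow 2) hcs
  rw [Finset.abs_prod]
  calc ∏ j, |cos (u j * t)| ≤ ∏ j, exp (-((u j * t) ^ 2 * q j ^ 2 / 2)) :=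
        Finset.prod_le_prod (fun _ _ => abs_nonneg _) fun j _ => aux_cos_abs _
    _ = exp (-(t ^ 2 / 2 * ∑ j, u j ^ 2 * q j ^ 2)) := by
        rw [← Real.exp_sum, Finset.mul_sum, ← Finset.sum_neg_distrib]
        congr 1; apply Finset.sum_congr rfl; intros; ring
    _ ≤ _ := by
        apply Real.exp_le_exp.2
        have := mul_le_mul_of_nonneg_left hsq (by positivity : 0 ≤ t ^ 2 / 2)
        nlinarith


/-- the constant error term away from the origin -/
noncomputable def auxD (b : ℝ) : ℝ :=
  exp (-((π / (2 * b) * (1 - b ^ 2 / 2)) ^ 2 / 2)) + exp (-((π / (2 * b)) ^ 2 / 2))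

lemma auxD_pos (b : ℝ) : 0 < auxD b := by unfold auxD; positivity

lemma aux_point_mid {n : ℕ} {u : Fin n → ℝ} {b : ℝ} (hb : 0 < b) (hb1 : b ≤ 0.55)
    (h2 : ∑ j, u j ^ 2 = 1)
    (h3 : ∑ j, |u j| ^ 3 ≤ b ^ 3) {t : ℝ} (ht0 : 0 ≤ t) (ht : t ≤ π / b ^ 3 - π / (2 * b)) :
    |∏ j, cos (u j * t) - exp (-(t ^ 2 / 2))| ≤ b ^ 4 * t ^ 4 / 4 * exp (-(t ^ 2 / 2)) + auxD b := by
  have hpi := Real.pi_pos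
  rcases le_or_gt t (π / (2 * b)) with h | h
  · have := aux_phi_near hb h2 h3 ht0 h
    linarith [auxD_pos b]
  · have ht1 : 0 < π / (2 * b) := by positivity
    have hle : b ^ 3 * t / π ≤ 1 := by
      rw [div_le_one hpi, mul_comm, ← le_div_iff₀ (by positivity)]; linarith
    have hf := aux_phi_far h2 h3 ht0 hle
    have hsum : b ^ 3 * (t + π / (2 * b)) / π ≤ 1 := by
      rw [div_le_one hpi, mul_comm, ← le_div_iff₀ (by positivity)]; linarith
    have hp1 : 0 ≤ π / (2 * b) * (1 - b ^ 2 / 2) := mul_nonneg ht1.le (by nlinarith)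
    have hp : π / (2 * b) * (1 - b ^ 2 / 2) ≤ t * (1 - b ^ 3 * t / π) := by
      have e : b ^ 2 / 2 = b ^ 3 * (π / (2 * b)) / π := by field_simp
      have e2 : t * (1 - b ^ 3 * t / π) - π / (2 * b) * (1 - b ^ 2 / 2)
          = (t - π / (2 * b)) * (1 - b ^ 3 * (t + π / (2 * b)) / π) := by rw [e]; ring
      have := mul_nonneg (sub_nonneg.2 h.le) (sub_nonneg.2 hsum)
      linarith
    have h5 : exp (-((t * (1 - b ^ 3 * t / π)) ^ 2 / 2)) ≤ exp (-((π / (2 * b) * (1 - b ^ 2 / 2)) ^ 2 / 2)) := by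
      apply exp_le_exp.2
      have := pow_le_pow_left₀ hp1 hp 2
      linarith
    have h6 : exp (-(t ^ 2 / 2)) ≤ exp (-((π / (2 * b)) ^ 2 / 2)) := by
      apply exp_le_exp.2
      have := pow_le_pow_left₀ ht1.le h.le 2
      linarith
    have h7 := abs_sub (∏ j, cos (u j * t)) (exp (-(t ^ 2 / 2)))
    rw [abs_of_pos (exp_pos (-(t ^ 2 / 2)))] at h7
    have h8 : 0 ≤ b ^ 4 * t ^ 4 / 4 * exp (-(t ^ 2 / 2)) := by positivity
    unfold auxD
    linarith

lemma aux_point_full {n : ℕ} {u : Fin n → ℝ} {b : ℝ} (hb : 0 < b) (hb1 : b ≤ 0.55)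
    (h2 : ∑ j, u j ^ 2 = 1)
    (h3 : ∑ j, |u j| ^ 3 ≤ b ^ 3) {t : ℝ} (ht0 : 0 ≤ t) (ht : t ≤ π / b ^ 3) :
    |∏ j, cos (u j * t) - exp (-(t ^ 2 / 2))| ≤ b ^ 4 * t ^ 4 / 4 * exp (-(t ^ 2 / 2)) + auxD b
      + exp (-((π / b ^ 3 - t) ^ 2 / 4)) := by
  have hpi := Real.pi_pos
  rcases le_or_gt t (π / b ^ 3 - π / (2 * b)) with h | h
  · have := aux_point_mid hb hb1 h2 h3 ht0 h
    linarith [exp_pos (-((π / b ^ 3 - t) ^ 2 / 4))]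
  · have ht1 : 0 < π / (2 * b) := by positivity
    have hle : b ^ 3 * t / π ≤ 1 := by
      rw [div_le_one hpi, mul_comm, ← le_div_iff₀ (by positivity)]; linarith
    have hf := aux_phi_far h2 h3 ht0 hle
    set s := π / b ^ 3 - t with hs
    have hs0 : 0 ≤ s := by linarith
    have hs1 : s ≤ π / (2 * b) := by linarith
    have e : t * (1 - b ^ 3 * t / π) = s * (1 - b ^ 3 * s / π) := by
      have : t = π / b ^ 3 - s := by rw [hs]; ring
      rw [this]; field_simp; ring
    have hbs : b ^ 3 * s / π ≤ b ^ 2 / 2 := by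
      calc b ^ 3 * s / π ≤ b ^ 3 * (π / (2 * b)) / π := by gcongr
        _ = b ^ 2 / 2 := by field_simp
    have hb2 : b ^ 2 / 2 ≤ 0.16 := by nlinarith
    have h84 : s * 0.84 ≤ t * (1 - b ^ 3 * t / π) := by
      rw [e]; exact mul_le_mul_of_nonneg_left (by linarith) hs0
    have h5 : exp (-((t * (1 - b ^ 3 * t / π)) ^ 2 / 2)) ≤ exp (-(s ^ 2 / 4)) := by
      apply exp_le_exp.2
      have := pow_le_pow_left₀ (by positivity) h84 2
      nlinarith
    have htt : π / (2 * b) ≤ t := by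
      have : π / (2 * b) + π / (2 * b) ≤ π / b ^ 3 := by
        rw [le_div_iff₀ (by positivity)]
        have : (π / (2 * b) + π / (2 * b)) * b ^ 3 = π * b ^ 2 := by field_simp; ring
        rw [this]; nlinarith
      linarith
    have h6 : exp (-(t ^ 2 / 2)) ≤ exp (-((π / (2 * b)) ^ 2 / 2)) := by
      apply exp_le_exp.2
      have := pow_le_pow_left₀ ht1.le htt 2
      linarith
    have h7 := abs_sub (∏ j, cos (u j * t)) (exp (-(t ^ 2 / 2)))
    rw [abs_of_pos (exp_pos (-(t ^ 2 / 2)))] at h7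
    have h8 : 0 ≤ b ^ 4 * t ^ 4 / 4 * exp (-(t ^ 2 / 2)) := by positivity
    have h9 := exp_pos (-((π / (2 * b) * (1 - b ^ 2 / 2)) ^ 2 / 2))
    unfold auxD
    linarith

lemma aux_exp_decay {v0 v c κ : ℝ} (hv0 : 2 ≤ v0) (hv : v0 ≤ v)
    (h : v0 ^ 2 * exp (-(1.2336 * (v0 - c))) ≤ κ) :
    v ^ 2 * exp (-(1.2336 * (v - c))) ≤ κ := by
  refine le_trans ?_ h
  have h1 : v / v0 ≤ exp (v / v0 - 1) := by linarith [add_one_le_exp (v / v0 - 1)]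
  have h2 : (v / v0) ^ 2 ≤ exp (1.2336 * (v - v0)) := by
    calc (v / v0) ^ 2 ≤ exp (v / v0 - 1) ^ 2 := by
          apply pow_le_pow_left₀ _ h1; apply div_nonneg <;> linarith
      _ = exp (2 * (v / v0 - 1)) := by rw [← Real.exp_nat_mul]; norm_num
      _ ≤ _ := by
          apply exp_le_exp.2
          have e : v / v0 - 1 = (v - v0) / v0 := by field_simp
          rw [e]
          have : (v - v0) / v0 ≤ (v - v0) / 2 := by
            apply div_le_div_of_nonneg_left <;> linarith
          linarith
  have e : exp (-(1.2336 * (v0 - c))) = exp (1.2336 * (v - v0)) * exp (-(1.2336 * (v - c))) := by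
    rw [← Real.exp_add]; congr 1; ring
  rw [e, ← mul_assoc]
  apply mul_le_mul_of_nonneg_right _ (exp_pos _).le
  have : v ^ 2 = v0 ^ 2 * (v / v0) ^ 2 := by field_simp
  rw [this]; gcongr

lemma aux_exp_num {y r q : ℝ} (m k : ℕ) (hm : 0 < m) (hr : 0 < r) (hk : (k : ℝ) / m ≤ y)
    (h : r ^ m ≤ 2.718 ^ k) (hq : 1 / r ≤ q) : exp (-y) ≤ q := by
  have hr' : r ≤ exp ((k : ℝ) / m) := by
    have : r ^ m ≤ exp ((k : ℝ) / m) ^ m := by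
      rw [← Real.exp_nat_mul]
      have e : (m : ℝ) * ((k : ℝ) / m) = k * 1 := by field_simp
      rw [e, Real.exp_nat_mul]
      refine h.trans (pow_le_pow_left₀ (by norm_num) ?_ k)
      linarith [Real.exp_one_gt_d9]
    exact le_of_pow_le_pow_left₀ hm.ne' (exp_pos _).le this
  rw [Real.exp_neg, ← one_div]
  refine le_trans ?_ hq
  exact one_div_le_one_div_of_le hr (hr'.trans (exp_le_exp.2 hk))

lemma auxD_le {b v0 κ1 κ2 : ℝ} (hb : 0 < b) (hv0 : 2 ≤ v0) (hbv : v0 * b ^ 2 ≤ 1)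
    (h1 : v0 ^ 2 * exp (-(1.2336 * (v0 - 1))) ≤ κ1) (h2 : v0 ^ 2 * exp (-(1.2336 * (v0 - 0))) ≤ κ2) :
    auxD b ≤ (κ1 + κ2) * b ^ 4 := by
  have hv : v0 ≤ 1 / b ^ 2 := by rw [le_div_iff₀ (by positivity)]; exact hbv
  have a1 := aux_exp_decay (c := 1) hv0 hv h1
  have a2 := aux_exp_decay (c := 0) hv0 hv h2
  have hpi : 3.14159 < π := Real.pi_gt_d6.trans_le' (by norm_num)
  have hpi2 : 1.2336 * 8 ≤ π ^ 2 := by nlinarith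
  set v := 1 / b ^ 2 with hvd
  have hvb : v * b ^ 2 = 1 := by rw [hvd]; field_simp
  have hv0' : 0 < v := by linarith
  have e2 : (π / (2 * b)) ^ 2 / 2 = π ^ 2 / 8 * v := by rw [hvd]; field_simp; ring
  have b1 : exp (-((π / (2 * b)) ^ 2 / 2)) ≤ exp (-(1.2336 * (v - 0))) := by
    apply exp_le_exp.2; rw [e2]; nlinarith
  have b2 : exp (-((π / (2 * b) * (1 - b ^ 2 / 2)) ^ 2 / 2)) ≤ exp (-(1.2336 * (v - 1))) := by
    apply exp_le_exp.2
    have e : (π / (2 * b) * (1 - b ^ 2 / 2)) ^ 2 / 2 = π ^ 2 / 8 * (v - 1 + b ^ 2 / 4) := by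
      have : (π / (2 * b) * (1 - b ^ 2 / 2)) ^ 2 / 2 = ((π / (2 * b)) ^ 2 / 2) * (1 - b ^ 2 / 2) ^ 2 := by ring
      rw [this, e2]
      linear_combination (π ^ 2 / 8 * (-1 + b ^ 2 / 4)) * hvb
    rw [e]
    have : 0 ≤ b ^ 2 := sq_nonneg b
    nlinarith
  have hb4 : b ^ 4 * v ^ 2 = 1 := by
    have : b ^ 4 * v ^ 2 = (v * b ^ 2) ^ 2 := by ring
    rw [this, hvb]; norm_num
  have hbp : 0 < b ^ 4 := by positivity
  unfold auxD
  have c1 := mul_le_mul_of_nonneg_left a1 hbp.le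
  have c2 := mul_le_mul_of_nonneg_left a2 hbp.le
  rw [← mul_assoc, hb4, one_mul] at c1 c2
  linarith

lemma auxD_le_big {b : ℝ} (hb : 0 < b) (hb1 : b ≤ 0.55) : auxD b ≤ 0.87 * b ^ 4 := by
  have h := auxD_le (v0 := 3.3) (κ1 := 0.665) (κ2 := 0.205) hb (by norm_num) (by nlinarith) ?_ ?_
  · refine h.trans (le_of_eq ?_); norm_num
  · have := aux_exp_num (y := 1.2336 * (3.3 - 1)) (r := 16.4) (q := 0.061) 5 14 (by norm_num) (by norm_num)
      (by norm_num) (by norm_num) (by norm_num)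
    linarith
  · have := aux_exp_num (y := 1.2336 * (3.3 - 0)) (r := 54) (q := 0.0186) 1 4 (by norm_num) (by norm_num)
      (by norm_num) (by norm_num) (by norm_num)
    linarith

lemma auxD_le_small {b : ℝ} (hb : 0 < b) (hb1 : b ≤ 0.41) : auxD b ≤ 0.12 * b ^ 4 := by
  have h := auxD_le (v0 := 5.9) (κ1 := 0.088) (κ2 := 0.032) hb (by norm_num) (by nlinarith) ?_ ?_
  · refine h.trans (le_of_eq ?_); norm_num
  · have := aux_exp_num (y := 1.2336 * (5.9 - 1)) (r := 402) (q := 0.0025) 1 6 (by norm_num) (by norm_num)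
      (by norm_num) (by norm_num) (by norm_num)
    linarith
  · have := aux_exp_num (y := 1.2336 * (5.9 - 0)) (r := 1094) (q := 0.000915) 1 7 (by norm_num) (by norm_num)
      (by norm_num) (by norm_num) (by norm_num)
    linarith


lemma aux_J1 {p : ℝ} (hp : p ≠ 0) : ∫ θ in (0:ℝ)..π, (π - θ) * cos (p * θ) = (1 - cos (p * π)) / p ^ 2 := by
  have h : ∀ θ ∈ Set.uIcc (0:ℝ) π, HasDerivAt (fun θ => (π - θ) * (sin (p * θ) / p) - cos (p * θ) / p ^ 2)
      ((π - θ) * cos (p * θ)) θ := by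
    intro θ _
    have h1 : HasDerivAt (fun θ : ℝ => p * θ) p θ := by simpa using (hasDerivAt_id θ).const_mul p
    have h2 := ((h1.sin).div_const p)
    have h3 := ((h1.cos).div_const (p ^ 2))
    have h4 : HasDerivAt (fun θ : ℝ => π - θ) (-1) θ := by simpa using (hasDerivAt_id θ).const_sub π
    refine ((h4.mul h2).sub h3).congr_deriv ?_
    field_simp
    ring
  rw [intervalIntegral.integral_eq_sub_of_hasDerivAt h]
  · simp
    field_simp
    ring
  · exact (by fun_prop : Continuous fun θ : ℝ => (π - θ) * cos (p * θ)).intervalIntegrable _ _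

lemma aux_Jc {p : ℝ} (hp : p ≠ 0) : ∫ θ in (0:ℝ)..π, cos (p * θ) = sin (p * π) / p := by
  have h : ∀ θ ∈ Set.uIcc (0:ℝ) π, HasDerivAt (fun θ => sin (p * θ) / p) (cos (p * θ)) θ := by
    intro θ _
    have h1 : HasDerivAt (fun θ : ℝ => p * θ) p θ := by simpa using (hasDerivAt_id θ).const_mul p
    refine ((h1.sin).div_const p).congr_deriv ?_
    field_simp
  rw [intervalIntegral.integral_eq_sub_of_hasDerivAt h]
  · simp
  · exact (by fun_prop : Continuous fun θ : ℝ => cos (p * θ)).intervalIntegrable _ _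

lemma aux_Js {p : ℝ} (hp : p ≠ 0) : ∫ θ in (0:ℝ)..π, sin (p * θ) = (1 - cos (p * π)) / p := by
  have h : ∀ θ ∈ Set.uIcc (0:ℝ) π, HasDerivAt (fun θ => - cos (p * θ) / p) (sin (p * θ)) θ := by
    intro θ _
    have h1 : HasDerivAt (fun θ : ℝ => p * θ) p θ := by simpa using (hasDerivAt_id θ).const_mul p
    refine ((h1.cos).neg.div_const p).congr_deriv ?_
    field_simp
  rw [intervalIntegral.integral_eq_sub_of_hasDerivAt h]
  · simp
    field_simp
    ring
  · exact (by fun_prop : Continuous fun θ : ℝ => sin (p * θ)).intervalIntegrable _ _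

noncomputable def auxHc (κ y : ℝ) : ℝ := ∫ v in (0:ℝ)..π, sin (κ * v) * cos (y * v)
noncomputable def auxHs (κ y : ℝ) : ℝ := ∫ v in (0:ℝ)..π, sin (κ * v) * sin (y * v)
noncomputable def auxAk (κ ρ θ : ℝ) : ℝ :=
  1 / 2 * ((1 - ρ * κ ^ 2) * ((π - θ) * cos (κ * θ)) + (1 + ρ * κ ^ 2) * (sin (κ * θ) / κ))

lemma auxHc_eq (κ y : ℝ) : auxHc κ y = 1 / 2 * ((∫ θ in (0:ℝ)..π, sin ((κ + y) * θ)) + ∫ θ in (0:ℝ)..π, sin ((κ - y) * θ)) := by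
  unfold auxHc
  rw [← intervalIntegral.integral_add, ← intervalIntegral.integral_const_mul]
  · congr 1; ext v
    rw [add_mul, sub_mul, sin_add, sin_sub]; ring
  · exact (by fun_prop : Continuous fun θ : ℝ => sin ((κ + y) * θ)).intervalIntegrable _ _
  · exact (by fun_prop : Continuous fun θ : ℝ => sin ((κ - y) * θ)).intervalIntegrable _ _

lemma auxHs_eq (κ y : ℝ) : auxHs κ y = 1 / 2 * ((∫ θ in (0:ℝ)..π, cos ((κ - y) * θ)) - ∫ θ in (0:ℝ)..π, cos ((κ + y) * θ)) := by
  unfold auxHs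
  rw [← intervalIntegral.integral_sub, ← intervalIntegral.integral_const_mul]
  · congr 1; ext v
    rw [add_mul, sub_mul, cos_add, cos_sub]; ring
  · exact (by fun_prop : Continuous fun θ : ℝ => cos ((κ - y) * θ)).intervalIntegrable _ _
  · exact (by fun_prop : Continuous fun θ : ℝ => cos ((κ + y) * θ)).intervalIntegrable _ _

lemma auxAk_int (κ ρ y : ℝ) : 2 * ∫ θ in (0:ℝ)..π, auxAk κ ρ θ * cos (y * θ) =
    (1 - ρ * κ ^ 2) * (1 / 2 * ((∫ θ in (0:ℝ)..π, (π - θ) * cos ((κ + y) * θ)) +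
      ∫ θ in (0:ℝ)..π, (π - θ) * cos ((κ - y) * θ))) + (1 + ρ * κ ^ 2) / κ * auxHc κ y := by
  unfold auxHc
  rw [← intervalIntegral.integral_add, ← intervalIntegral.integral_const_mul, ← intervalIntegral.integral_const_mul,
    ← intervalIntegral.integral_const_mul, ← intervalIntegral.integral_const_mul, ← intervalIntegral.integral_add]
  · congr 1; ext v
    unfold auxAk
    rw [add_mul κ y v, sub_mul κ y v, cos_add, cos_sub]; ring
  · apply Continuous.intervalIntegrable; fun_prop
  · apply Continuous.intervalIntegrable; fun_prop
  · apply Continuous.intervalIntegrable; fun_prop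
  · apply Continuous.intervalIntegrable; fun_prop

lemma auxAk_eq {κ ρ y : ℝ} (hκ : 0 < κ) (hy : 0 ≤ y) (hs : sin (κ * π) = 0) :
    2 * ∫ θ in (0:ℝ)..π, auxAk κ ρ θ * cos (y * θ) = (1 - ρ * y ^ 2) * (auxHc κ y ^ 2 + auxHs κ y ^ 2) := by
  have hp : κ + y ≠ 0 := by positivity
  have hc : cos (κ * π) ^ 2 = 1 := by nlinarith [sin_sq_add_cos_sq (κ * π)]
  have hcy := sin_sq_add_cos_sq (y * π)
  rw [auxAk_int, auxHs_eq, auxHc_eq, aux_J1 hp, aux_Jc hp, aux_Js hp]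
  by_cases hq : κ - y = 0
  · have : y = κ := by linarith
    subst this
    have e1 : ∫ θ in (0:ℝ)..π, (π - θ) = π ^ 2 / 2 := by
      rw [intervalIntegral.integral_sub (by simp) (by simp)]
      simp; ring
    have e2 : cos ((y + y) * π) = 1 := by
      rw [add_mul, cos_add, hs]; nlinarith
    have e3 : sin ((y + y) * π) = 0 := by
      rw [add_mul, sin_add, hs]; ring
    simp [e1, e2, e3]
    left; ring
  · rw [aux_J1 hq, aux_Jc hq, aux_Js hq]
    have e1 : cos ((κ + y) * π) = cos (κ * π) * cos (y * π) := by rw [add_mul, cos_add, hs]; ring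
    have e2 : cos ((κ - y) * π) = cos (κ * π) * cos (y * π) := by rw [sub_mul, cos_sub, hs]; ring
    have e3 : sin ((κ + y) * π) = cos (κ * π) * sin (y * π) := by rw [add_mul, sin_add, hs]; ring
    have e4 : sin ((κ - y) * π) = - (cos (κ * π) * sin (y * π)) := by rw [sub_mul, sin_sub, hs]; ring
    rw [e1, e2, e3, e4]
    have key : (cos (κ * π) * sin (y * π)) ^ 2 = 1 - (cos (κ * π) * cos (y * π)) ^ 2 := by
      rw [mul_pow, mul_pow, hc]; linarith
    generalize cos (κ * π) * cos (y * π) = C at *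
    generalize cos (κ * π) * sin (y * π) = S at *
    have L : (1 / 2 * (-S / (κ - y) - S / (κ + y))) ^ 2 = κ ^ 2 * S ^ 2 / ((κ - y) ^ 2 * (κ + y) ^ 2) := by
      field_simp; ring
    rw [L, key]
    field_simp
    ring

lemma aux_bessel1 (N : ℕ) (g : ℝ → ℝ) (hg : Continuous g) :
    ∑ k ∈ range N, (∫ v in (0:ℝ)..π, sin (((k:ℝ) + 1) * v) * g v) ^ 2 ≤ π / 2 * ∫ v in (0:ℝ)..π, g v ^ 2 := by
  have orth : ∀ j k : ℕ, ∫ v in (0:ℝ)..π, sin (((j:ℝ) + 1) * v) * sin (((k:ℝ) + 1) * v) =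
      if j = k then π / 2 else 0 := by
    intro j k
    have := auxHs_eq (j + 1) (k + 1)
    unfold auxHs at this
    have hp : ((j:ℝ) + 1 + (k + 1)) ≠ 0 := by positivity
    rw [this, aux_Jc hp]
    have e : sin (((j:ℝ) + 1 + (k + 1)) * π) = 0 := by
      have := sin_nat_mul_pi (j + 1 + (k + 1)); push_cast at this; exact this
    rw [e]
    split_ifs with h
    · subst h; simp; ring
    · have hq : ((j:ℝ) + 1 - (k + 1)) ≠ 0 := by
        intro h'; apply h; have : (j:ℝ) = k := by linarith
        exact_mod_cast this
      rw [aux_Jc hq]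
      have e : sin (((j:ℝ) + 1 - (k + 1)) * π) = 0 := by
        have := sin_int_mul_pi ((j:ℤ) + 1 - (k + 1)); push_cast at this; exact this
      rw [e]; simp
  set c : ℕ → ℝ := fun k => ∫ v in (0:ℝ)..π, sin (((k:ℝ) + 1) * v) * g v with hcdef
  have h0 : 0 ≤ ∫ v in (0:ℝ)..π, (g v - ∑ k ∈ range N, 2 / π * c k * sin (((k:ℝ) + 1) * v)) ^ 2 :=
    intervalIntegral.integral_nonneg pi_pos.le (fun v _ => sq_nonneg _)
  have ex : ∀ v : ℝ, (g v - ∑ k ∈ range N, 2 / π * c k * sin (((k:ℝ) + 1) * v)) ^ 2 =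
      g v ^ 2 - ∑ k ∈ range N, (4 / π * c k) * (sin (((k:ℝ) + 1) * v) * g v) +
      ∑ j ∈ range N, ∑ k ∈ range N, (2 / π * c j * (2 / π * c k)) * (sin (((j:ℝ) + 1) * v) * sin (((k:ℝ) + 1) * v)) := by
    intro v
    have : ∑ j ∈ range N, ∑ k ∈ range N, (2 / π * c j * (2 / π * c k)) * (sin (((j:ℝ) + 1) * v) * sin (((k:ℝ) + 1) * v))
      = (∑ k ∈ range N, 2 / π * c k * sin (((k:ℝ) + 1) * v)) ^ 2 := by
      rw [sq, sum_mul_sum]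
      refine sum_congr rfl fun j _ => sum_congr rfl fun k _ => by ring
    rw [this]
    have : ∑ k ∈ range N, (4 / π * c k) * (sin (((k:ℝ) + 1) * v) * g v) = 2 * g v * ∑ k ∈ range N, 2 / π * c k * sin (((k:ℝ) + 1) * v) := by
      rw [mul_sum]
      refine sum_congr rfl fun j _ => by ring
    rw [this]; ring
  simp_rw [ex] at h0
  rw [intervalIntegral.integral_add, intervalIntegral.integral_sub, intervalIntegral.integral_finsetSum,
    intervalIntegral.integral_finsetSum] at h0
  · have e2 : ∀ j ∈ range N, ∫ v in (0:ℝ)..π, ∑ k ∈ range N, (2 / π * c j * (2 / π * c k)) * (sin (((j:ℝ) + 1) * v) * sin (((k:ℝ) + 1) * v)) = 2 / π * c j ^ 2 := by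
      intro j hj
      rw [intervalIntegral.integral_finsetSum]
      · simp_rw [intervalIntegral.integral_const_mul, orth]
        simp only [mul_ite, mul_zero, sum_ite_eq, hj, if_true]
        field_simp
      · intro i _; apply Continuous.intervalIntegrable; fun_prop
    rw [sum_congr rfl e2] at h0
    simp_rw [intervalIntegral.integral_const_mul] at h0
    change 0 ≤ _ - ∑ k ∈ range N, 4 / π * c k * c k + _ at h0
    have e3 : ∑ k ∈ range N, 4 / π * c k * c k = 2 * ∑ k ∈ range N, 2 / π * c k ^ 2 := by
      rw [mul_sum]; refine sum_congr rfl fun j _ => by ring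
    rw [e3, ← mul_sum] at h0
    change ∑ k ∈ range N, c k ^ 2 ≤ _
    have h1 : 2 / π * ∑ k ∈ range N, c k ^ 2 ≤ ∫ v in (0:ℝ)..π, g v ^ 2 := by linarith
    have := mul_le_mul_of_nonneg_left h1 (by positivity : 0 ≤ π / 2)
    calc _ = π / 2 * (2 / π * ∑ k ∈ range N, c k ^ 2) := by field_simp
      _ ≤ _ := this
  · intro i _; apply Continuous.intervalIntegrable; fun_prop
  · intro i _; apply Continuous.intervalIntegrable; fun_prop
  · apply Continuous.intervalIntegrable; fun_prop
  · apply Continuous.intervalIntegrable; fun_prop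
  · apply Continuous.intervalIntegrable; fun_prop
  · apply Continuous.intervalIntegrable; fun_prop

lemma aux_bessel (N : ℕ) (y : ℝ) :
    ∑ k ∈ range N, (auxHc ((k:ℝ) + 1) y ^ 2 + auxHs ((k:ℝ) + 1) y ^ 2) ≤ π ^ 2 / 2 := by
  rw [sum_add_distrib]
  have h1 := aux_bessel1 N (fun v => cos (y * v)) (by fun_prop)
  have h2 := aux_bessel1 N (fun v => sin (y * v)) (by fun_prop)
  have h3 : (∫ v in (0:ℝ)..π, cos (y * v) ^ 2) + ∫ v in (0:ℝ)..π, sin (y * v) ^ 2 = π := by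
    rw [← intervalIntegral.integral_add]
    · simp
    · apply Continuous.intervalIntegrable; fun_prop
    · apply Continuous.intervalIntegrable; fun_prop
  unfold auxHc auxHs
  have : π / 2 * (∫ v in (0:ℝ)..π, cos (y * v) ^ 2) + π / 2 * ∫ v in (0:ℝ)..π, sin (y * v) ^ 2 = π ^ 2 / 2 := by
    rw [← mul_add, h3]; ring
  linarith

noncomputable def auxA (N : ℕ) (ρ θ : ℝ) : ℝ := ∑ k ∈ range N, auxAk ((k:ℝ) + 1) ρ θ

lemma auxAk_cont (κ ρ : ℝ) : Continuous (auxAk κ ρ) := by unfold auxAk; fun_prop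
lemma auxA_cont (N : ℕ) (ρ : ℝ) : Continuous (auxA N ρ) := by
  unfold auxA; exact continuous_finsetSum _ fun k _ => auxAk_cont _ _

lemma auxA_kernel (N : ℕ) {ρ : ℝ} (hρ : 0 ≤ ρ) (y : ℝ) :
    4 / π ^ 2 * ∫ θ in (0:ℝ)..π, auxA N ρ θ * cos (y * θ) ≤ if ρ * y ^ 2 < 1 then 1 else 0 := by
  have hab : ∀ θ, cos (y * θ) = cos (|y| * θ) := by
    intro θ
    rcases abs_choice y with h | h <;> rw [h]
    rw [neg_mul, cos_neg]
  simp_rw [hab]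
  have e : ∫ θ in (0:ℝ)..π, auxA N ρ θ * cos (|y| * θ) = ∑ k ∈ range N, ∫ θ in (0:ℝ)..π, auxAk ((k:ℝ) + 1) ρ θ * cos (|y| * θ) := by
    rw [← intervalIntegral.integral_finsetSum]
    · unfold auxA; simp_rw [sum_mul]
    · intro k _
      exact ((auxAk_cont _ _).mul (by fun_prop)).intervalIntegrable _ _
  have e2 : 2 * ∫ θ in (0:ℝ)..π, auxA N ρ θ * cos (|y| * θ) = (1 - ρ * y ^ 2) * ∑ k ∈ range N, (auxHc ((k:ℝ) + 1) |y| ^ 2 + auxHs ((k:ℝ) + 1) |y| ^ 2) := by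
    rw [e, mul_sum, mul_sum]
    refine sum_congr rfl fun k _ => ?_
    have hs : sin (((k:ℝ) + 1) * π) = 0 := by
      have := sin_nat_mul_pi (k + 1); push_cast at this; exact this
    rw [auxAk_eq (by positivity) (abs_nonneg y) hs, sq_abs]
  have hb := aux_bessel N |y|
  have hb0 : 0 ≤ ∑ k ∈ range N, (auxHc ((k:ℝ) + 1) |y| ^ 2 + auxHs ((k:ℝ) + 1) |y| ^ 2) := sum_nonneg fun k _ => by positivity
  have e3 : 4 / π ^ 2 * ∫ θ in (0:ℝ)..π, auxA N ρ θ * cos (|y| * θ) = 2 / π ^ 2 * ((1 - ρ * y ^ 2) * ∑ k ∈ range N, (auxHc ((k:ℝ) + 1) |y| ^ 2 + auxHs ((k:ℝ) + 1) |y| ^ 2)) := by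
    rw [← e2]; ring
  rw [e3]
  generalize (∑ k ∈ range N, (auxHc ((k:ℝ) + 1) |y| ^ 2 + auxHs ((k:ℝ) + 1) |y| ^ 2)) = X at *
  have hρy : 0 ≤ ρ * y ^ 2 := by positivity
  split_ifs with h
  · rw [div_mul_eq_mul_div, div_le_one (by positivity)]
    nlinarith
  · apply mul_nonpos_of_nonneg_of_nonpos (by positivity)
    exact mul_nonpos_of_nonpos_of_nonneg (by linarith) hb0

lemma aux_charfun {n : ℕ} (u : Fin n → ℝ) (t : ℝ) :
    ∑ x : Fin n → Bool, cos (t * ∑ j, u j * pm (x j)) = 2 ^ n * ∏ j, cos (u j * t) := by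
  have hC : ∑ x : Fin n → Bool, Complex.exp ((t * ∑ j, u j * pm (x j) : ℝ) * Complex.I) =
      ((2 ^ n * ∏ j, cos (u j * t) : ℝ) : ℂ) := by
    have h1 : ∀ x : Fin n → Bool, Complex.exp ((t * ∑ j, u j * pm (x j) : ℝ) * Complex.I) =
        ∏ j, Complex.exp ((t * (u j * pm (x j)) : ℝ) * Complex.I) := by
      intro x
      rw [← Complex.exp_sum, ← sum_mul, mul_sum]
      push_cast; rfl
    simp_rw [h1]
    have h2 := Finset.prod_univ_sum (fun _ : Fin n => (univ : Finset Bool))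
      (fun j b => Complex.exp ((t * (u j * pm b) : ℝ) * Complex.I))
    rw [Fintype.piFinset_univ] at h2
    rw [← h2]
    have h3 : ∀ j : Fin n, ∑ b : Bool, Complex.exp ((t * (u j * pm b) : ℝ) * Complex.I) = 2 * ((cos (u j * t) : ℝ) : ℂ) := by
      intro j
      rw [Fintype.sum_bool]
      simp only [pm]
      push_cast
      rw [Complex.cos]
      push_cast
      field_simp
    simp_rw [h3]
    rw [prod_mul_distrib]
    simp
  have := congrArg Complex.re hC
  rw [Complex.ofReal_re, Complex.re_sum] at this
  simp_rw [Complex.exp_ofReal_mul_I_re] at this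
  exact this

lemma aux_prob_lower {n : ℕ} (u : Fin n → ℝ) (N : ℕ) {R a : ℝ} (hR : 0 < R) (ha : 0 < a) :
    4 / π ^ 2 * ∫ θ in (0:ℝ)..π, auxA N (R ^ 2 / a ^ 2) θ * ∏ j, cos (u j * (θ / R)) ≤
      unifPr n (fun x => |∑ j, u j * pm (x j)| < a) := by
  have hk : ∀ x : Fin n → Bool, 4 / π ^ 2 * ∫ θ in (0:ℝ)..π, auxA N (R ^ 2 / a ^ 2) θ * cos ((θ / R) * ∑ j, u j * pm (x j))
      ≤ if |∑ j, u j * pm (x j)| < a then 1 else 0 := by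
    intro x
    have h := auxA_kernel N (by positivity : 0 ≤ R ^ 2 / a ^ 2) ((∑ j, u j * pm (x j)) / R)
    have e : (R ^ 2 / a ^ 2 * ((∑ j, u j * pm (x j)) / R) ^ 2 < 1) ↔ |∑ j, u j * pm (x j)| < a := by
      rw [show R ^ 2 / a ^ 2 * ((∑ j, u j * pm (x j)) / R) ^ 2 = (∑ j, u j * pm (x j)) ^ 2 / a ^ 2 by field_simp,
        div_lt_one (by positivity), sq_lt_sq, abs_of_pos ha]
    simp only [e] at h
    refine le_trans (le_of_eq ?_) h
    congr 2; ext θ; congr 2; ring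
  have hs := Finset.sum_le_sum (s := univ) (fun x _ => hk x)
  rw [← mul_sum, ← intervalIntegral.integral_finsetSum] at hs
  · simp_rw [← mul_sum, aux_charfun] at hs
    unfold unifPr
    rw [le_div_iff₀ (by positivity), card_filter]
    push_cast
    refine le_trans (le_of_eq ?_) hs
    rw [mul_assoc, ← intervalIntegral.integral_mul_const]
    congr 2; ext θ; ring
  · intro x _
    exact ((auxA_cont _ _).mul (by fun_prop)).intervalIntegrable _ _

lemma aux_prob_lower' {n : ℕ} (u : Fin n → ℝ) (N : ℕ) {R a : ℝ} (hR : 0 < R) (ha : 0 < a) :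
    4 * R / π ^ 2 * ∫ t in (0:ℝ)..(π / R), auxA N (R ^ 2 / a ^ 2) (R * t) * ∏ j, cos (u j * t) ≤
      unifPr n (fun x => |∑ j, u j * pm (x j)| < a) := by
  refine le_trans (le_of_eq ?_) (aux_prob_lower u N hR ha)
  have h := intervalIntegral.integral_comp_mul_left (a := 0) (b := π / R) (c := R)
    (fun θ => auxA N (R ^ 2 / a ^ 2) θ * ∏ j, cos (u j * (θ / R))) hR.ne'
  rw [mul_zero, show R * (π / R) = π by field_simp] at h
  have e : ∀ t : ℝ, R * t / R = t := fun t => by field_simp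
  simp only [e] at h
  rw [h, smul_eq_mul]
  field_simp


lemma aux_gauss_tendsto : Filter.Tendsto (fun S : ℝ => ∫ t in (0:ℝ)..S, exp (-(t ^ 2 / 2))) Filter.atTop
    (nhds (sqrt (π / 2))) := by
  have hi : IntegrableOn (fun t : ℝ => exp (-(t ^ 2 / 2))) (Set.Ioi 0) := by
    have := (integrable_exp_neg_mul_sq (by norm_num : (0:ℝ) < 1 / 2)).integrableOn (s := Set.Ioi 0)
    refine this.congr_fun (fun t _ => ?_) measurableSet_Ioi
    simp only []; congr 1; ring
  have h := intervalIntegral_tendsto_integral_Ioi 0 hi Filter.tendsto_id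
  have e : ∫ t in Set.Ioi (0:ℝ), exp (-(t ^ 2 / 2)) = sqrt (π / 2) := by
    have := integral_gaussian_Ioi (1 / 2)
    rw [show sqrt (π / 2) = sqrt (π / (1 / 2)) / 2 by
      rw [show π / (1 / 2) = 2 ^ 2 * (π / 2) by ring, sqrt_mul (by norm_num), sqrt_sq (by norm_num)]; ring, ← this]
    congr 1; ext t; congr 1; ring
  rw [e] at h
  exact h

lemma aux_gauss_moment {A0 B E T : ℝ} (hB : 0 ≤ B) (hE : 0 ≤ E) (hT : 0 < T) (hA : A0 ≤ B * T ^ 2) :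
    sqrt (π / 2) * (A0 - B - 3 * E) ≤ ∫ t in (0:ℝ)..T, (A0 - B * t ^ 2 - E * t ^ 4) * exp (-(t ^ 2 / 2)) := by
  have hform : ∀ S : ℝ, ∫ t in (0:ℝ)..S, (A0 - B * t ^ 2 - E * t ^ 4) * exp (-(t ^ 2 / 2)) =
      (A0 - B - 3 * E) * (∫ t in (0:ℝ)..S, exp (-(t ^ 2 / 2))) + (B * S + 3 * E * S + E * S ^ 3) * exp (-(S ^ 2 / 2)) := by
    intro S
    have hd : ∀ t ∈ Set.uIcc 0 S, HasDerivAt (fun S => (B * S + 3 * E * S + E * S ^ 3) * exp (-(S ^ 2 / 2)))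
        ((A0 - B * t ^ 2 - E * t ^ 4) * exp (-(t ^ 2 / 2)) - (A0 - B - 3 * E) * exp (-(t ^ 2 / 2))) t := by
      intro t _
      have h1 : HasDerivAt (fun S : ℝ => -(S ^ 2 / 2)) (-t) t := by
        refine (((hasDerivAt_pow 2 t).div_const 2).neg).congr_deriv ?_
        simp
      have h2 : HasDerivAt (fun S : ℝ => (B * S + 3 * E * S + E * S ^ 3)) (B + 3 * E + E * (3 * t ^ 2)) t := by
        refine ((((hasDerivAt_id t).const_mul B).add ((hasDerivAt_id t).const_mul (3 * E))).add ((hasDerivAt_pow 3 t).const_mul E)).congr_deriv ?_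
        simp
      refine (h2.mul h1.exp).congr_deriv ?_
      ring
    have := intervalIntegral.integral_eq_sub_of_hasDerivAt hd (by apply Continuous.intervalIntegrable; fun_prop)
    rw [intervalIntegral.integral_sub, intervalIntegral.integral_const_mul] at this
    · simp at this
      linarith
    · apply Continuous.intervalIntegrable; fun_prop
    · apply Continuous.intervalIntegrable; fun_prop
  have hlim : Filter.Tendsto (fun S : ℝ => (A0 - B - 3 * E) * ∫ t in (0:ℝ)..S, exp (-(t ^ 2 / 2))) Filter.atTop
      (nhds ((A0 - B - 3 * E) * sqrt (π / 2))) := aux_gauss_tendsto.const_mul _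
  rw [mul_comm]
  refine le_of_tendsto hlim ?_
  filter_upwards [Filter.eventually_ge_atTop T] with S hS
  have hS0 : 0 < S := by linarith
  have h1 : ∫ t in T..S, (A0 - B * t ^ 2 - E * t ^ 4) * exp (-(t ^ 2 / 2)) ≤ 0 := by
    have h0 : 0 ≤ ∫ t in T..S, - ((A0 - B * t ^ 2 - E * t ^ 4) * exp (-(t ^ 2 / 2))) := by
      apply intervalIntegral.integral_nonneg hS
      intro t ht
      have : B * T ^ 2 ≤ B * t ^ 2 := by
        have : T ≤ t := ht.1
        gcongr
      have h4 : 0 ≤ E * t ^ 4 := by positivity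
      rw [← neg_mul]
      apply mul_nonneg _ (exp_pos _).le
      linarith
    rw [intervalIntegral.integral_neg] at h0
    linarith
  have h2 := intervalIntegral.integral_add_adjacent_intervals (μ := volume) (a := 0) (b := T) (c := S)
    (f := fun t => (A0 - B * t ^ 2 - E * t ^ 4) * exp (-(t ^ 2 / 2)))
    (by apply Continuous.intervalIntegrable; fun_prop) (by apply Continuous.intervalIntegrable; fun_prop)
  have h3 := hform S
  have h4 : 0 ≤ (B * S + 3 * E * S + E * S ^ 3) * exp (-(S ^ 2 / 2)) := by positivity
  linarith

lemma aux_int_est {g φ : ℝ → ℝ} (hg : Continuous g) (hφ : Continuous φ) {R A0 γ c1 c2 K F D b : ℝ}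
    (hR : 0 < R) (hγ : 0 ≤ γ) (hK : 0 ≤ K) (hF : 0 ≤ F) (hneg : A0 ≤ γ * π ^ 2)
    (hA : ∀ t, 0 ≤ t → t ≤ π / R → A0 - γ * R ^ 2 * t ^ 2 ≤ g t)
    (hE : ∀ t, 0 ≤ t → t ≤ π / R → |g t| * |φ t - exp (-(t ^ 2 / 2))| ≤
      K * (b ^ 4 / 4) * t ^ 4 * exp (-(t ^ 2 / 2)) + (c1 * (π - R * t) + c2) * D
        + F * ((π / R - t) * exp (-((π / R - t) ^ 2 / 4)))) :
    sqrt (π / 2) * (A0 - γ * R ^ 2 - 3 * (K * (b ^ 4 / 4))) - 2 * F - (c1 * π ^ 2 / 2 + c2 * π) * D / R ≤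
      ∫ t in (0:ℝ)..(π / R), g t * φ t := by
  have hT : 0 < π / R := by positivity
  have h1 := aux_gauss_moment (A0 := A0) (B := γ * R ^ 2) (E := K * (b ^ 4 / 4)) (T := π / R) (by positivity)
    (by positivity) hT (by rw [div_pow]; field_simp; linarith)
  have h2 : ∫ t in (0:ℝ)..(π / R), (c1 * (π - R * t) + c2) * D = (c1 * π ^ 2 / 2 + c2 * π) * D / R := by
    have hd : ∀ t ∈ Set.uIcc 0 (π / R), HasDerivAt (fun t => (c1 * (π * t - R * t ^ 2 / 2) + c2 * t) * D)
        ((c1 * (π - R * t) + c2) * D) t := by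
      intro t _
      refine (((((hasDerivAt_id t).const_mul π).sub (((hasDerivAt_pow 2 t).const_mul R).div_const 2)).const_mul c1).add ((hasDerivAt_id t).const_mul c2) |>.mul_const D).congr_deriv ?_
      simp; left; left; ring
    rw [intervalIntegral.integral_eq_sub_of_hasDerivAt hd (by apply Continuous.intervalIntegrable; fun_prop)]
    field_simp
    ring
  have h3 : ∫ t in (0:ℝ)..(π / R), F * ((π / R - t) * exp (-((π / R - t) ^ 2 / 4))) ≤ 2 * F := by
    have hd : ∀ t ∈ Set.uIcc 0 (π / R), HasDerivAt (fun t => F * (2 * exp (-((π / R - t) ^ 2 / 4))))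
        (F * ((π / R - t) * exp (-((π / R - t) ^ 2 / 4)))) t := by
      intro t _
      have h4 : HasDerivAt (fun t : ℝ => π / R - t) (-1) t := by simpa using (hasDerivAt_id t).const_sub (π / R)
      refine ((((h4.pow 2).div_const 4).neg.exp.const_mul 2).const_mul F).congr_deriv ?_
      simp; ring
    rw [intervalIntegral.integral_eq_sub_of_hasDerivAt hd (by apply Continuous.intervalIntegrable; fun_prop)]
    have : 0 ≤ F * (2 * exp (-((π / R - 0) ^ 2 / 4))) := by positivity
    simp at this ⊢
    linarith
  have h4 : ∫ t in (0:ℝ)..(π / R), ((A0 - γ * R ^ 2 * t ^ 2 - K * (b ^ 4 / 4) * t ^ 4) * exp (-(t ^ 2 / 2))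
      - (c1 * (π - R * t) + c2) * D - F * ((π / R - t) * exp (-((π / R - t) ^ 2 / 4)))) ≤ ∫ t in (0:ℝ)..(π / R), g t * φ t := by
    apply intervalIntegral.integral_mono_on hT.le
    · apply Continuous.intervalIntegrable; fun_prop
    · apply Continuous.intervalIntegrable; fun_prop
    · intro t ht
      have ha := hA t ht.1 ht.2
      have he := hE t ht.1 ht.2
      rw [← abs_mul] at he
      have h5 := neg_abs_le (g t * (φ t - exp (-(t ^ 2 / 2))))
      have h6 := mul_le_mul_of_nonneg_right ha (exp_pos (-(t ^ 2 / 2))).le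
      nlinarith
  rw [intervalIntegral.integral_sub, intervalIntegral.integral_sub] at h4
  · linarith
  all_goals apply Continuous.intervalIntegrable; fun_prop


lemma auxAk_lower {κ ρ θ : ℝ} (hκ : 0 < κ) (hρ : 0 ≤ ρ) (h0 : 0 ≤ θ) (h1 : θ ≤ π) :
    π / 2 * (1 - ρ * κ ^ 2) - 1 / 2 * (|1 - ρ * κ ^ 2| * (π / 2) * κ ^ 2 + (1 + ρ * κ ^ 2) * κ / π) * θ ^ 2 ≤ auxAk κ ρ θ := by
  unfold auxAk
  have hs : θ - κ * θ ^ 2 / π ≤ sin (κ * θ) / κ := by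
    rw [le_div_iff₀ hκ]
    have := aux_sin_lower (by positivity : 0 ≤ κ * θ)
    refine le_trans (le_of_eq ?_) this
    ring
  have hc1 := cos_le_one (κ * θ)
  have hc2 := one_sub_sq_div_two_le_cos (x := κ * θ)
  have hc : (1 - ρ * κ ^ 2) * (π - θ) - |1 - ρ * κ ^ 2| * (π / 2) * κ ^ 2 * θ ^ 2 ≤ (1 - ρ * κ ^ 2) * ((π - θ) * cos (κ * θ)) := by
    generalize 1 - ρ * κ ^ 2 = c
    have h4 : (π - θ) * (1 - cos (κ * θ)) ≤ π / 2 * κ ^ 2 * θ ^ 2 := by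
      have : (π - θ) * (1 - cos (κ * θ)) ≤ π * ((κ * θ) ^ 2 / 2) := by
        apply mul_le_mul <;> linarith [pi_pos]
      linarith
    have h5 : 0 ≤ (π - θ) * (1 - cos (κ * θ)) := mul_nonneg (by linarith) (by linarith)
    have h6 := mul_le_mul_of_nonneg_left h4 (abs_nonneg c)
    have h7 := mul_le_mul_of_nonneg_right (le_abs_self c) h5
    linarith
  have h3 : 0 ≤ 1 + ρ * κ ^ 2 := by positivity
  have h4 := mul_le_mul_of_nonneg_left hs h3
  have h5 : 0 ≤ ρ * κ ^ 2 * θ := by positivity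
  have e : (1 + ρ * κ ^ 2) * κ / π * θ ^ 2 = (1 + ρ * κ ^ 2) * (κ * θ ^ 2 / π) := by ring
  nlinarith

lemma auxAk_abs {κ ρ θ : ℝ} (hκ : 0 < κ) (hρ : 0 ≤ ρ) (h1 : θ ≤ π) :
    |auxAk κ ρ θ| ≤ 1 / 2 * |1 - ρ * κ ^ 2| * (π - θ) + 1 / 2 * ((1 + ρ * κ ^ 2) / κ) := by
  unfold auxAk
  have h3 : 0 ≤ 1 + ρ * κ ^ 2 := by positivity
  have a1 : |(1 - ρ * κ ^ 2) * ((π - θ) * cos (κ * θ))| ≤ |1 - ρ * κ ^ 2| * (π - θ) := by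
    rw [abs_mul, abs_mul, abs_of_nonneg (by linarith : 0 ≤ π - θ)]
    gcongr
    exact mul_le_of_le_one_right (by linarith) (abs_cos_le_one _)
  have a2 : |(1 + ρ * κ ^ 2) * (sin (κ * θ) / κ)| ≤ (1 + ρ * κ ^ 2) / κ := by
    rw [abs_mul, abs_div, abs_of_nonneg h3, abs_of_pos hκ, div_eq_mul_inv, div_eq_mul_inv]
    gcongr
    exact mul_le_of_le_one_left (by positivity) (abs_sin_le_one _)
  rw [abs_mul, abs_of_pos (by norm_num : (0:ℝ) < 1 / 2)]
  have := abs_add_le ((1 - ρ * κ ^ 2) * ((π - θ) * cos (κ * θ))) ((1 + ρ * κ ^ 2) * (sin (κ * θ) / κ))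
  linarith

lemma auxAk_abs' {κ ρ θ : ℝ} (hκ : 0 < κ) (hρ : 0 ≤ ρ) (h1 : θ ≤ π) (hs : sin (κ * π) = 0) :
    |auxAk κ ρ θ| ≤ 1 / 2 * (|1 - ρ * κ ^ 2| + (1 + ρ * κ ^ 2)) * (π - θ) := by
  unfold auxAk
  have h3 : 0 ≤ 1 + ρ * κ ^ 2 := by positivity
  have a1 : |(1 - ρ * κ ^ 2) * ((π - θ) * cos (κ * θ))| ≤ |1 - ρ * κ ^ 2| * (π - θ) := by
    rw [abs_mul, abs_mul, abs_of_nonneg (by linarith : 0 ≤ π - θ)]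
    gcongr
    exact mul_le_of_le_one_right (by linarith) (abs_cos_le_one _)
  have a2 : |(1 + ρ * κ ^ 2) * (sin (κ * θ) / κ)| ≤ (1 + ρ * κ ^ 2) * (π - θ) := by
    rw [abs_mul, abs_div, abs_of_nonneg h3, abs_of_pos hκ]
    gcongr
    rw [div_le_iff₀ hκ]
    have e : sin (κ * (π - θ)) = - (cos (κ * π) * sin (κ * θ)) := by
      rw [mul_sub, sin_sub, hs]; ring
    have e1 : |cos (κ * π)| = 1 := by
      have := sin_sq_add_cos_sq (κ * π)
      rw [hs] at this
      have h : cos (κ * π) ^ 2 = 1 := by linarith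
      rw [← sq_abs] at h
      nlinarith [abs_nonneg (cos (κ * π))]
    have e2 : |sin (κ * θ)| = |sin (κ * (π - θ))| := by
      rw [e, abs_neg, abs_mul, e1, one_mul]
    rw [e2]
    have := abs_sin_le_abs (x := κ * (π - θ))
    rw [abs_of_nonneg (mul_nonneg hκ.le (by linarith : 0 ≤ π - θ))] at this
    linarith
  rw [abs_mul, abs_of_pos (by norm_num : (0:ℝ) < 1 / 2)]
  have := abs_add_le ((1 - ρ * κ ^ 2) * ((π - θ) * cos (κ * θ))) ((1 + ρ * κ ^ 2) * (sin (κ * θ) / κ))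
  linarith

lemma auxA_lower (N : ℕ) {ρ θ G : ℝ} (hρ : 0 ≤ ρ) (h0 : 0 ≤ θ) (h1 : θ ≤ π)
    (hG : ∑ k ∈ range N, 1 / 2 * (|1 - ρ * ((k:ℝ) + 1) ^ 2| * (π / 2) * ((k:ℝ) + 1) ^ 2 + (1 + ρ * ((k:ℝ) + 1) ^ 2) * ((k:ℝ) + 1) / π) ≤ G) :
    π / 2 * ∑ k ∈ range N, (1 - ρ * ((k:ℝ) + 1) ^ 2) - G * θ ^ 2 ≤ auxA N ρ θ := by
  have h := Finset.sum_le_sum (s := range N) (fun k _ => auxAk_lower (κ := (k:ℝ) + 1) (by positivity) hρ h0 h1)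
  rw [sum_sub_distrib, ← mul_sum, ← sum_mul] at h
  have := mul_le_mul_of_nonneg_right hG (sq_nonneg θ)
  unfold auxA
  linarith

lemma auxA_abs (N : ℕ) {ρ θ c1 c2 : ℝ} (hρ : 0 ≤ ρ) (h1 : θ ≤ π)
    (hc1 : ∑ k ∈ range N, 1 / 2 * |1 - ρ * ((k:ℝ) + 1) ^ 2| ≤ c1)
    (hc2 : ∑ k ∈ range N, 1 / 2 * ((1 + ρ * ((k:ℝ) + 1) ^ 2) / ((k:ℝ) + 1)) ≤ c2) :
    |auxA N ρ θ| ≤ c1 * (π - θ) + c2 := by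
  have h := Finset.sum_le_sum (s := range N) (fun k _ => auxAk_abs (κ := (k:ℝ) + 1) (by positivity) hρ h1)
  rw [sum_add_distrib, ← sum_mul] at h
  have := mul_le_mul_of_nonneg_right hc1 (by linarith : 0 ≤ π - θ)
  unfold auxA
  have := abs_sum_le_sum_abs (fun k : ℕ => auxAk ((k:ℝ) + 1) ρ θ) (range N)
  linarith

lemma auxA_abs' (N : ℕ) {ρ θ C : ℝ} (hρ : 0 ≤ ρ) (h1 : θ ≤ π)
    (hC : ∑ k ∈ range N, 1 / 2 * (|1 - ρ * ((k:ℝ) + 1) ^ 2| + (1 + ρ * ((k:ℝ) + 1) ^ 2)) ≤ C) :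
    |auxA N ρ θ| ≤ C * (π - θ) := by
  have h := Finset.sum_le_sum (s := range N) (fun k _ => auxAk_abs' (κ := (k:ℝ) + 1) (by positivity) hρ h1 (by
    have := sin_nat_mul_pi (k + 1); push_cast at this; exact this))
  rw [← sum_mul] at h
  have := mul_le_mul_of_nonneg_right hC (by linarith : 0 ≤ π - θ)
  unfold auxA
  have := abs_sum_le_sum_abs (fun k : ℕ => auxAk ((k:ℝ) + 1) ρ θ) (range N)
  linarith

lemma aux_neg (N : ℕ) {ρ G : ℝ} (hρ : 0 ≤ ρ)
    (hG : ∑ k ∈ range N, 1 / 2 * (|1 - ρ * ((k:ℝ) + 1) ^ 2| * (π / 2) * ((k:ℝ) + 1) ^ 2 + (1 + ρ * ((k:ℝ) + 1) ^ 2) * ((k:ℝ) + 1) / π) ≤ G) :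
    π / 2 * ∑ k ∈ range N, (1 - ρ * ((k:ℝ) + 1) ^ 2) ≤ G * π ^ 2 := by
  refine le_trans ?_ (mul_le_mul_of_nonneg_right hG (sq_nonneg π))
  rw [mul_sum, sum_mul]
  refine sum_le_sum fun k _ => ?_
  have h1 : 0 ≤ (1 + ρ * ((k:ℝ) + 1) ^ 2) * ((k:ℝ) + 1) / π := by positivity
  have h2 := le_abs_self (1 - ρ * ((k:ℝ) + 1) ^ 2)
  have h3 : (1:ℝ) ≤ ((k:ℝ) + 1) ^ 2 := by
    have : (0:ℝ) ≤ k := by positivity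
    nlinarith
  have h4 := abs_nonneg (1 - ρ * ((k:ℝ) + 1) ^ 2)
  have hpi := pi_gt_three
  calc π / 2 * (1 - ρ * ((k:ℝ) + 1) ^ 2) ≤ π / 2 * |1 - ρ * ((k:ℝ) + 1) ^ 2| := by gcongr
    _ ≤ (1 / 2 * (|1 - ρ * ((k:ℝ) + 1) ^ 2| * (π / 2) * 1 + 0)) * π ^ 2 := by
        have : 0 ≤ |1 - ρ * ((k:ℝ) + 1) ^ 2| * π := by positivity
        have h9 : (9:ℝ) ≤ π ^ 2 := by nlinarith
        have := mul_le_mul_of_nonneg_left h9 this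
        linarith
    _ ≤ _ := by gcongr

lemma aux_master {n : ℕ} (u : Fin n → ℝ) (N : ℕ) {R a b c1 c2 G F D : ℝ} (hR : 0 < R) (ha : 0 < a)
    (hF : 0 ≤ F) (hG : ∑ k ∈ range N, 1 / 2 * (|1 - R ^ 2 / a ^ 2 * ((k:ℝ) + 1) ^ 2| * (π / 2) * ((k:ℝ) + 1) ^ 2 + (1 + R ^ 2 / a ^ 2 * ((k:ℝ) + 1) ^ 2) * ((k:ℝ) + 1) / π) ≤ G)
    (hc1 : ∑ k ∈ range N, 1 / 2 * |1 - R ^ 2 / a ^ 2 * ((k:ℝ) + 1) ^ 2| ≤ c1)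
    (hc2 : ∑ k ∈ range N, 1 / 2 * ((1 + R ^ 2 / a ^ 2 * ((k:ℝ) + 1) ^ 2) / ((k:ℝ) + 1)) ≤ c2)
    (hE : ∀ t, 0 ≤ t → t ≤ π / R → ∃ X, |auxA N (R ^ 2 / a ^ 2) (R * t)| * X ≤ F * ((π / R - t) * exp (-((π / R - t) ^ 2 / 4))) ∧ 
      |∏ j, cos (u j * t) - exp (-(t ^ 2 / 2))| ≤ b ^ 4 * t ^ 4 / 4 * exp (-(t ^ 2 / 2)) + D + X) (hD : 0 ≤ D) :
    (sqrt (2 * π))⁻¹ * (2 * R * ∑ k ∈ range N, (1 - R ^ 2 / a ^ 2 * ((k:ℝ) + 1) ^ 2) - 4 / π * G * R ^ 3 - 3 / π * R * (c1 * π + c2) * b ^ 4)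
      - 8 / π ^ 2 * R * F - (2 * c1 + 4 / π * c2) * D ≤ unifPr n (fun x => |∑ j, u j * pm (x j)| < a) := by
  refine le_trans ?_ (aux_prob_lower' u N hR ha)
  have hρ : 0 ≤ R ^ 2 / a ^ 2 := by positivity
  have hRt : ∀ t, t ≤ π / R → R * t ≤ π := by
    intro t ht
    rw [le_div_iff₀ hR] at ht
    linarith
  have hc1' : 0 ≤ c1 := le_trans (sum_nonneg fun k _ => by positivity) hc1
  have hc2' : 0 ≤ c2 := le_trans (sum_nonneg fun k _ => by positivity) hc2
  have hG' : 0 ≤ G := le_trans (sum_nonneg fun k _ => by positivity) hG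
  have h := aux_int_est (g := fun t => auxA N (R ^ 2 / a ^ 2) (R * t)) (φ := fun t => ∏ j, cos (u j * t))
    ((auxA_cont _ _).comp (by fun_prop)) (by fun_prop) (R := R) (γ := G) (c1 := c1) (c2 := c2) (K := c1 * π + c2)
    (F := F) (D := D) (b := b) hR hG' (by positivity) hF (aux_neg N hρ hG)
    (by
      intro t h0 h1
      have := auxA_lower N hρ (by positivity) (hRt t h1) hG
      refine le_trans (le_of_eq ?_) this
      ring)
    (by
      intro t h0 h1
      obtain ⟨X, hX1, hX2⟩ := hE t h0 h1
      have hA1 := auxA_abs N hρ (hRt t h1) hc1 hc2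
      have hA2 : |auxA N (R ^ 2 / a ^ 2) (R * t)| ≤ c1 * π + c2 := by
        have : 0 ≤ c1 * (R * t) := by positivity
        linarith
      have h3 := mul_le_mul_of_nonneg_left hX2 (abs_nonneg (auxA N (R ^ 2 / a ^ 2) (R * t)))
      have h4 : 0 ≤ b ^ 4 * t ^ 4 / 4 * exp (-(t ^ 2 / 2)) := by positivity
      have h5 := mul_le_mul_of_nonneg_right hA2 h4
      have h6 := mul_le_mul_of_nonneg_right hA1 hD
      linarith)
  have h' := mul_le_mul_of_nonneg_left h (by positivity : 0 ≤ 4 * R / π ^ 2)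
  refine le_trans (le_of_eq ?_) h'
  have e : sqrt (π / 2) = π * (sqrt (2 * π))⁻¹ := by
    rw [← div_eq_mul_inv, eq_div_iff (by positivity), ← sqrt_mul (by positivity)]
    rw [show π / 2 * (2 * π) = π ^ 2 by ring, sqrt_sq pi_pos.le]
  rw [e]
  generalize (∑ k ∈ range N, (1 - R ^ 2 / a ^ 2 * ((k:ℝ) + 1) ^ 2)) = Z
  generalize (sqrt (2 * π))⁻¹ = s
  field_simp
  ring


lemma aux_s_bounds : 0.3989 ≤ (sqrt (2 * π))⁻¹ ∧ (sqrt (2 * π))⁻¹ ≤ 0.39895 := by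
  have h1 : 2.5066 ≤ sqrt (2 * π) := by
    apply le_sqrt_of_sq_le; nlinarith [pi_gt_d6]
  have h2 : sqrt (2 * π) ≤ 2.50675 := by
    rw [sqrt_le_iff]; constructor
    · norm_num
    · nlinarith [pi_lt_d4]
  have hp : 0 < sqrt (2 * π) := by linarith
  constructor
  · rw [le_inv_comm₀ (by norm_num) hp]; refine h2.trans ?_; norm_num
  · rw [inv_le_comm₀ hp (by norm_num)]; refine le_trans ?_ h1; norm_num

lemma aux_ipi : π⁻¹ ≤ 0.3184 := by
  rw [inv_le_comm₀ pi_pos (by norm_num)]; refine le_trans ?_ pi_gt_d4.le; norm_num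

lemma aux_full {n : ℕ} (u : Fin n → ℝ) (N : ℕ) {a b : ℝ} (hb : 0 < b) (hb1 : b ≤ 0.41) (ha : 0 < a)
    (h2 : ∑ j, u j ^ 2 = 1) (h3 : ∑ j, |u j| ^ 3 ≤ b ^ 3)
    (hG : ∑ k ∈ range N, 1 / 2 * (|1 - (b ^ 3) ^ 2 / a ^ 2 * ((k:ℝ) + 1) ^ 2| * (π / 2) * ((k:ℝ) + 1) ^ 2 + (1 + (b ^ 3) ^ 2 / a ^ 2 * ((k:ℝ) + 1) ^ 2) * ((k:ℝ) + 1) / π) ≤ 10)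
    (hc1 : ∑ k ∈ range N, 1 / 2 * |1 - (b ^ 3) ^ 2 / a ^ 2 * ((k:ℝ) + 1) ^ 2| ≤ 1.28)
    (hc2 : ∑ k ∈ range N, 1 / 2 * ((1 + (b ^ 3) ^ 2 / a ^ 2 * ((k:ℝ) + 1) ^ 2) / ((k:ℝ) + 1)) ≤ 1.4)
    (hC : ∑ k ∈ range N, 1 / 2 * (|1 - (b ^ 3) ^ 2 / a ^ 2 * ((k:ℝ) + 1) ^ 2| + (1 + (b ^ 3) ^ 2 / a ^ 2 * ((k:ℝ) + 1) ^ 2)) ≤ 3.9) :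
    (sqrt (2 * π))⁻¹ * (2 * b ^ 3 * ∑ k ∈ range N, (1 - (b ^ 3) ^ 2 / a ^ 2 * ((k:ℝ) + 1) ^ 2)) - 3.41 * b ^ 4 ≤
      unifPr n (fun x => |∑ j, u j * pm (x j)| < a) := by
  have hR : 0 < b ^ 3 := by positivity
  have hm := aux_master u N (b := b) (D := auxD b) (F := 3.9 * b ^ 3) hR ha (by positivity) hG hc1 hc2
    (by
      intro t h0 h1
      refine ⟨exp (-((π / b ^ 3 - t) ^ 2 / 4)), ?_, aux_point_full hb (by linarith) h2 h3 h0 h1⟩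
      have hRt : b ^ 3 * t ≤ π := by
        rw [le_div_iff₀ hR] at h1
        linarith
      have := auxA_abs' N (by positivity) hRt hC
      rw [show π - b ^ 3 * t = b ^ 3 * (π / b ^ 3 - t) by field_simp] at this
      have := mul_le_mul_of_nonneg_right this (exp_pos (-((π / b ^ 3 - t) ^ 2 / 4))).le
      linarith) (auxD_pos b).le
  refine le_trans ?_ hm
  have hD := auxD_le_small hb hb1
  obtain ⟨hs1, hs2⟩ := aux_s_bounds
  have hp := aux_ipi
  have hp0 : 0 < π⁻¹ := by positivity
  have hpi := pi_lt_d2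
  rw [show 4 / π = 4 * π⁻¹ by ring, show 3 / π = 3 * π⁻¹ by ring, show 8 / π ^ 2 = 8 * π⁻¹ ^ 2 by field_simp]
  generalize (sqrt (2 * π))⁻¹ = s at *
  generalize (∑ k ∈ range N, (1 - (b ^ 3) ^ 2 / a ^ 2 * ((k:ℝ) + 1) ^ 2)) = Z at *
  have hs0 : 0 ≤ s := by linarith
  have t1 : s * (4 * π⁻¹ * 10 * (b ^ 3) ^ 3) ≤ 0.4 * (4 * 0.3184 * 10 * (b ^ 4 * 0.41 ^ 5)) := by
    rw [show (b ^ 3) ^ 3 = b ^ 4 * b ^ 5 by ring]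
    gcongr; linarith
  have t2 : s * (3 * π⁻¹ * b ^ 3 * (1.28 * π + 1.4) * b ^ 4) ≤ 0.4 * (3 * 0.3184 * 0.41 ^ 3 * (1.28 * 3.15 + 1.4) * b ^ 4) := by
    gcongr; linarith
  have t3 : 8 * π⁻¹ ^ 2 * b ^ 3 * (3.9 * b ^ 3) ≤ 8 * 0.3184 ^ 2 * 3.9 * (b ^ 4 * 0.41 ^ 2) := by
    rw [show 8 * π⁻¹ ^ 2 * b ^ 3 * (3.9 * b ^ 3) = 8 * π⁻¹ ^ 2 * 3.9 * (b ^ 4 * b ^ 2) by ring]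
    gcongr
  have t4 : (2 * 1.28 + 4 * π⁻¹ * 1.4) * auxD b ≤ (2 * 1.28 + 4 * 0.3184 * 1.4) * (0.12 * b ^ 4) := by
    have := (auxD_pos b).le
    gcongr
  have hb4 : 0 < b ^ 4 := by positivity
  rw [mul_sub, mul_sub]
  norm_num at t1 t2 t3 t4 ⊢
  linarith

lemma aux_rho {a b r1 : ℝ} (ha : 0 < a) (hb : 0 < b) (hr : 0 < r1) (h : r1 * b ^ 3 ≤ a) : (b ^ 3) ^ 2 / a ^ 2 ≤ 1 / r1 ^ 2 := by
  rw [div_le_div_iff₀ (by positivity) (by positivity), one_mul, ← mul_pow]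
  have : 0 < b ^ 3 := by positivity
  gcongr
  linarith

lemma aux_rho' {a b r1 : ℝ} (ha : 0 < a) (hr : 0 < r1) (h : a ≤ r1 * b ^ 3) : 1 / r1 ^ 2 ≤ (b ^ 3) ^ 2 / a ^ 2 := by
  rw [div_le_div_iff₀ (by positivity) (by positivity), one_mul, ← mul_pow]
  gcongr
  linarith

lemma aux_case1 {n : ℕ} (u : Fin n → ℝ) {a b : ℝ} (hb : 0 < b) (hb1 : b ≤ 0.41) (ha : 0 < a)
    (h2 : ∑ j, u j ^ 2 = 1) (h3 : ∑ j, |u j| ^ 3 ≤ b ^ 3) (h4 : b ^ 3 ≤ a) (h5 : a ≤ 2.5 * b ^ 3) :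
    (sqrt (2 * π))⁻¹ * (a - b ^ 3) - 3.41 * b ^ 4 ≤ unifPr n (fun x => |∑ j, u j * pm (x j)| < a) := by
  have r1 := aux_rho ha hb one_pos (by linarith)
  have r2 := aux_rho' ha (by norm_num) h5
  norm_num at r1 r2
  have hab : |1 - (b ^ 3) ^ 2 / a ^ 2| = 1 - (b ^ 3) ^ 2 / a ^ 2 := abs_of_nonneg (by linarith)
  have hp := aux_ipi
  have hp0 : 0 < π⁻¹ := by positivity
  have hpi := pi_lt_d2
  have hpi0 := pi_pos
  have := aux_full u 1 hb hb1 ha h2 h3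
    (by
      simp only [sum_range_one, Nat.cast_zero, zero_add, one_pow, mul_one, hab]
      generalize (b ^ 3) ^ 2 / a ^ 2 = ρ at *
      rw [div_eq_mul_inv (1 + ρ)]
      have : (1 - ρ) * (π / 2) ≤ 1 * (3.15 / 2) := by gcongr <;> linarith
      have : (1 + ρ) * π⁻¹ ≤ 2 * 0.3184 := by gcongr; linarith
      linarith)
    (by
      simp only [sum_range_one, Nat.cast_zero, zero_add, one_pow, mul_one, hab]
      linarith)
    (by
      simp only [sum_range_one, Nat.cast_zero, zero_add, one_pow, mul_one]
      linarith)
    (by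
      simp only [sum_range_one, Nat.cast_zero, zero_add, one_pow, mul_one, hab]
      linarith)
  refine le_trans ?_ this
  simp only [sum_range_one, Nat.cast_zero, zero_add, one_pow, mul_one]
  have hs : 0 ≤ (sqrt (2 * π))⁻¹ := by positivity
  have : a - b ^ 3 ≤ 2 * b ^ 3 * (1 - (b ^ 3) ^ 2 / a ^ 2) := by
    have hl : 0 < b ^ 3 := by positivity
    generalize b ^ 3 = l at *
    rw [show 2 * l * (1 - l ^ 2 / a ^ 2) = 2 * l * (a ^ 2 - l ^ 2) / a ^ 2 by field_simp, le_div_iff₀ (by positivity)]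
    have : 0 ≤ (a - l) * (2 * l * (a + l) - a ^ 2) := by
      apply mul_nonneg (by linarith); nlinarith
    nlinarith
  have := mul_le_mul_of_nonneg_left this hs
  linarith

lemma aux_case2 {n : ℕ} (u : Fin n → ℝ) {a b : ℝ} (hb : 0 < b) (hb1 : b ≤ 0.41) (ha : 0 < a)
    (h2 : ∑ j, u j ^ 2 = 1) (h3 : ∑ j, |u j| ^ 3 ≤ b ^ 3) (h4 : 2.5 * b ^ 3 ≤ a) (h5 : a ≤ 4.5 * b ^ 3) :
    (sqrt (2 * π))⁻¹ * (a - b ^ 3) - 3.41 * b ^ 4 ≤ unifPr n (fun x => |∑ j, u j * pm (x j)| < a) := by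
  have r1 := aux_rho ha hb (by norm_num) h4
  have r0 : 0 ≤ (b ^ 3) ^ 2 / a ^ 2 := by positivity
  norm_num at r1
  have hp := aux_ipi
  have hp0 : 0 < π⁻¹ := by positivity
  have hpi := pi_lt_d2
  have hpi0 := pi_pos
  have r2 := aux_rho' ha (by norm_num) h5
  norm_num at r2
  have a1 : |1 - (b ^ 3) ^ 2 / a ^ 2 * 1| ≤ 1 := by rw [abs_le]; constructor <;> linarith
  have a2 : |1 - (b ^ 3) ^ 2 / a ^ 2 * 4| ≤ 1 := by rw [abs_le]; constructor <;> linarith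
  have a3 : |1 - (b ^ 3) ^ 2 / a ^ 2 * 9| ≤ 0.56 := by rw [abs_le]; constructor <;> linarith
  have e1 : ((0:ℝ) + 1) ^ 2 = 1 := by norm_num
  have e2 : ((1:ℝ) + 1) ^ 2 = 4 := by norm_num
  have e3 : ((2:ℝ) + 1) ^ 2 = 9 := by norm_num
  have := aux_full u 3 hb hb1 ha h2 h3
    (by
      simp only [sum_range_succ, sum_range_zero, Nat.cast_zero, Nat.cast_one, Nat.cast_ofNat, e1, e2, e3]
      generalize (b ^ 3) ^ 2 / a ^ 2 = ρ at *
      simp only [div_eq_mul_inv _ π]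
      have t1 : |1 - ρ * 1| * (π / 2) ≤ 1 * (3.15 / 2) := by gcongr
      have t2 : |1 - ρ * 4| * (π / 2) ≤ 1 * (3.15 / 2) := by gcongr
      have t3 : |1 - ρ * 9| * (π / 2) ≤ 0.56 * (3.15 / 2) := by gcongr
      have s1 : ρ * π⁻¹ ≤ 0.16 * 0.3184 := by gcongr; linarith
      norm_num at s1 t1 t2 t3 ⊢
      linarith)
    (by
      simp only [sum_range_succ, sum_range_zero, Nat.cast_zero, Nat.cast_one, Nat.cast_ofNat, e1, e2, e3]
      linarith)
    (by
      simp only [sum_range_succ, sum_range_zero, Nat.cast_zero, Nat.cast_one, Nat.cast_ofNat, e1, e2, e3]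
      norm_num
      linarith)
    (by
      simp only [sum_range_succ, sum_range_zero, Nat.cast_zero, Nat.cast_one, Nat.cast_ofNat, e1, e2, e3]
      linarith)
  refine le_trans ?_ this
  simp only [sum_range_succ, sum_range_zero, Nat.cast_zero, Nat.cast_one, Nat.cast_ofNat, e1, e2, e3]
  have hs : 0 ≤ (sqrt (2 * π))⁻¹ := by positivity
  have : a - b ^ 3 ≤ 2 * b ^ 3 * (3 - 14 * ((b ^ 3) ^ 2 / a ^ 2)) := by
    have hl : 0 < b ^ 3 := by positivity
    generalize b ^ 3 = l at *
    rw [show 2 * l * (3 - 14 * (l ^ 2 / a ^ 2)) = 2 * l * (3 * a ^ 2 - 14 * l ^ 2) / a ^ 2 by field_simp, le_div_iff₀ (by positivity)]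
    obtain ⟨r, rfl⟩ : ∃ r, a = r * l := ⟨a / l, by field_simp⟩
    have q1 : 2.5 ≤ r := le_of_mul_le_mul_right h4 hl
    have q2 : r ≤ 4.5 := le_of_mul_le_mul_right h5 hl
    have : 0 ≤ 7 * r ^ 2 - r ^ 3 - 28 := by
      nlinarith [mul_nonneg (sub_nonneg.2 q1) (sub_nonneg.2 q2), mul_nonneg (mul_nonneg (sub_nonneg.2 q1) (sub_nonneg.2 q2)) (by linarith : 0 ≤ r)]
    have := mul_nonneg this (by positivity : 0 ≤ l ^ 3)
    nlinarith
  have := mul_le_mul_of_nonneg_left this hs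
  linarith

lemma aux_case3 {n : ℕ} (u : Fin n → ℝ) {a b : ℝ} (hb : 0 < b) (hb1 : b ≤ 0.55) (ha : 0 < a)
    (h2 : ∑ j, u j ^ 2 = 1) (h3 : ∑ j, |u j| ^ 3 ≤ b ^ 3) (h4 : 4.5 * b ^ 3 ≤ a) (h5 : a ≤ 1.4143) :
    (sqrt (2 * π))⁻¹ * (a - b ^ 3 - a ^ 3 / 6) - 3.4106 * b ^ 4 ≤ unifPr n (fun x => |∑ j, u j * pm (x j)| < a) := by
  have hp := aux_ipi
  have hp0 : 0 < π⁻¹ := by positivity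
  have hpi := pi_lt_d4
  have hpi0 := pi_pos
  have e1 : ((0:ℝ) + 1) ^ 2 = 1 := by norm_num
  have e2 : ((1:ℝ) + 1) ^ 2 = 4 := by norm_num
  have e3 : ((2:ℝ) + 1) ^ 2 = 9 := by norm_num
  have hρ : (a / 3.6) ^ 2 / a ^ 2 = 25 / 324 := by field_simp; norm_num
  have a1 : |(1:ℝ) - 25 / 324 * 1| = 299 / 324 := by rw [abs_of_pos] <;> norm_num
  have a2 : |(1:ℝ) - 25 / 324 * 4| = 224 / 324 := by rw [abs_of_pos] <;> norm_num
  have a3 : |(1:ℝ) - 25 / 324 * 9| = 99 / 324 := by rw [abs_of_pos] <;> norm_num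
  have hR : 0 < a / 3.6 := by positivity
  have hl : 0 < b ^ 3 := by positivity
  have hm := aux_master u 3 (b := b) (D := auxD b) (F := 0) (G := 6.47) (c1 := 0.96) (c2 := 1.1482) hR ha le_rfl
    (by
      simp only [sum_range_succ, sum_range_zero, Nat.cast_zero, Nat.cast_one, Nat.cast_ofNat, e1, e2, e3, hρ, a1, a2, a3]
      simp only [div_eq_mul_inv _ π]
      norm_num at hpi hp ⊢
      linarith)
    (by
      simp only [sum_range_succ, sum_range_zero, Nat.cast_zero, Nat.cast_one, Nat.cast_ofNat, e1, e2, e3, hρ, a1, a2, a3]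
      norm_num)
    (by
      simp only [sum_range_succ, sum_range_zero, Nat.cast_zero, Nat.cast_one, Nat.cast_ofNat, e1, e2, e3, hρ, a1, a2, a3]
      norm_num)
    (by
      intro t h0 h1
      refine ⟨0, by simp, ?_⟩
      rw [add_zero]
      refine aux_point_mid hb hb1 h2 h3 h0 (h1.trans ?_)
      have : π / (a / 3.6) ≤ 0.8 * (π / b ^ 3) := by
        rw [show 0.8 * (π / b ^ 3) = π / (1.25 * b ^ 3) by field_simp; norm_num]
        have : 1.25 * b ^ 3 ≤ a / 3.6 := by
          rw [le_div_iff₀ (by norm_num)]; linarith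
        gcongr
      have : π / (2 * b) ≤ 0.2 * (π / b ^ 3) := by
        rw [show 0.2 * (π / b ^ 3) = π / (5 * b ^ 3) by field_simp; norm_num]
        have : 5 * b ^ 3 ≤ 2 * b := by
          have : b ^ 2 ≤ 0.55 ^ 2 := by gcongr
          rw [show 5 * b ^ 3 = (5 * b ^ 2) * b by ring]
          gcongr
          linarith
        gcongr
      linarith) (auxD_pos b).le
  refine le_trans ?_ hm
  simp only [sum_range_succ, sum_range_zero, Nat.cast_zero, Nat.cast_one, Nat.cast_ofNat, e1, e2, e3, hρ]
  have hD := auxD_le_big hb hb1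
  obtain ⟨hs1, hs2⟩ := aux_s_bounds
  rw [show 4 / π = 4 * π⁻¹ by ring, show 3 / π = 3 * π⁻¹ by ring]
  generalize (sqrt (2 * π))⁻¹ = s at *
  have hs0 : 0 ≤ s := by linarith
  have hb4 : 0 < b ^ 4 := by positivity
  have t1 : 4 * π⁻¹ * 6.47 * (a / 3.6) ^ 3 ≤ 4 * 0.3184 * 6.47 * (a ^ 3 / 46.656) := by
    rw [show (a / 3.6) ^ 3 = a ^ 3 / 46.656 by ring]
    gcongr
  have t2 : s * (3 * π⁻¹ * (a / 3.6) * (0.96 * π + 1.1482) * b ^ 4) ≤ 0.39895 * (3 * 0.3184 * (1.4143 / 3.6) * (0.96 * 3.1416 + 1.1482) * b ^ 4) := by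
    gcongr
  have t4 : (2 * 0.96 + 4 * π⁻¹ * 1.1482) * auxD b ≤ (2 * 0.96 + 4 * 0.3184 * 1.1482) * (0.87 * b ^ 4) := by
    have := (auxD_pos b).le
    gcongr
  have t5 : 0.3989 * b ^ 3 ≤ s * b ^ 3 := by gcongr
  have t6 : b ^ 4 ≤ 0.55 * b ^ 3 := by
    rw [show b ^ 4 = b * b ^ 3 by ring]; gcongr
  have t7 : 0 ≤ s * (2 * (a / 3.6) * (0 + (1 - 25 / 324 * 1) + (1 - 25 / 324 * 4) + (1 - 25 / 324 * 9)) - 4 * π⁻¹ * 6.47 * (a / 3.6) ^ 3 - (a - a ^ 3 / 6)) := by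
    apply mul_nonneg hs0
    have : a ^ 3 ≤ 1.4143 ^ 2 * a := by
      rw [show a ^ 3 = a ^ 2 * a by ring]; gcongr
    norm_num at t1 this ⊢
    linarith
  norm_num at t2 t4 t6 t7 ⊢
  linarith

lemma unifPr_mono {n : ℕ} {E F : (Fin n → Bool) → Prop} (h : ∀ x, E x → F x) : unifPr n E ≤ unifPr n F := by
  unfold unifPr
  gcongr with x
  exact h _

lemma unifPr_nonneg {n : ℕ} (E : (Fin n → Bool) → Prop) : 0 ≤ unifPr n E := by
  unfold unifPr; positivity

lemma aux_normalized_small {n : ℕ} (u : Fin n → ℝ) {a b : ℝ} (hb : 0 < b) (ha : 0 < a) (h5 : a ≤ 1.4143)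
    (h2 : ∑ j, u j ^ 2 = 1) (h3 : ∑ j, |u j| ^ 3 ≤ b ^ 3) :
    (sqrt (2 * π))⁻¹ * (a - b ^ 3 - a ^ 3 / 6) - 3.4106 * b ^ 4 ≤ unifPr n (fun x => |∑ j, u j * pm (x j)| < a) := by
  by_cases hpos : (sqrt (2 * π))⁻¹ * (a - b ^ 3 - a ^ 3 / 6) - 3.4106 * b ^ 4 ≤ 0
  · exact hpos.trans (unifPr_nonneg _)
  push Not at hpos
  obtain ⟨hs1, hs2⟩ := aux_s_bounds
  have hs0 : 0 < (sqrt (2 * π))⁻¹ := by positivity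
  have hl : 0 < b ^ 3 := by positivity
  have hb4 : 0 < b ^ 4 := by positivity
  have ha3 : 0 < a ^ 3 := by positivity
  have hgap : 8.545 * b ^ 4 ≤ a - b ^ 3 - a ^ 3 / 6 := by
    by_contra hcon
    push Not at hcon
    have : (sqrt (2 * π))⁻¹ * (a - b ^ 3 - a ^ 3 / 6) ≤ (sqrt (2 * π))⁻¹ * (8.545 * b ^ 4) := by gcongr
    have : (sqrt (2 * π))⁻¹ * (8.545 * b ^ 4) ≤ 0.39895 * (8.545 * b ^ 4) := by gcongr
    linarith
  have hb55 : b ≤ 0.55 := by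
    by_contra hcon
    push Not at hcon
    have q1 : (0.55:ℝ) ^ 3 ≤ b ^ 3 := by gcongr
    have q2 : (0.55:ℝ) ^ 4 ≤ b ^ 4 := by gcongr
    have q3 : a - a ^ 3 / 6 ≤ 0.945 := by
      nlinarith [mul_nonneg (sq_nonneg (a - 1.4142)) (by linarith : 0 ≤ a + 2.8284)]
    norm_num at q1 q2
    linarith
  by_cases c : a ≤ 4.5 * b ^ 3
  · have hb41 : b ≤ 0.41 := by
      have : 8.545 * b * b ^ 3 ≤ 3.5 * b ^ 3 := by
        have : 8.545 * b * b ^ 3 = 8.545 * b ^ 4 := by ring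
        linarith
      have := le_of_mul_le_mul_right this hl
      linarith
    have hfin : (sqrt (2 * π))⁻¹ * (a - b ^ 3 - a ^ 3 / 6) ≤ (sqrt (2 * π))⁻¹ * (a - b ^ 3) := by
      apply mul_le_mul_of_nonneg_left _ hs0.le
      linarith
    by_cases c2 : a ≤ 2.5 * b ^ 3
    · have := aux_case1 u hb hb41 ha h2 h3 (by linarith) c2
      linarith
    · have := aux_case2 u hb hb41 ha h2 h3 (by linarith) c
      linarith
  · exact aux_case3 u hb hb55 ha h2 h3 (by linarith) h5

lemma aux_normalized {n : ℕ} (u : Fin n → ℝ) {a b : ℝ} (hb : 0 < b) (ha : 0 < a)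
    (h2 : ∑ j, u j ^ 2 = 1) (h3 : ∑ j, |u j| ^ 3 ≤ b ^ 3) :
    (sqrt (2 * π))⁻¹ * (a - b ^ 3 - a ^ 3 / 6) - 3.4106 * b ^ 4 ≤ unifPr n (fun x => |∑ j, u j * pm (x j)| < a) := by
  by_cases h5 : a ≤ sqrt 2
  · exact aux_normalized_small u hb ha (h5.trans (by rw [sqrt_le_iff]; norm_num)) h2 h3
  · push Not at h5
    have h6 := aux_normalized_small u hb (by positivity) (by rw [sqrt_le_iff]; norm_num : sqrt 2 ≤ 1.4143) h2 h3
    have h7 : unifPr n (fun x => |∑ j, u j * pm (x j)| < sqrt 2) ≤ unifPr n (fun x => |∑ j, u j * pm (x j)| < a) :=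
      unifPr_mono fun x hx => hx.trans h5
    refine le_trans ?_ (h6.trans h7)
    have hq : sqrt 2 ^ 2 = 2 := sq_sqrt (by norm_num)
    have hq0 : 0 ≤ sqrt 2 := sqrt_nonneg 2
    have : a - a ^ 3 / 6 ≤ sqrt 2 - sqrt 2 ^ 3 / 6 := by
      generalize sqrt 2 = q at *
      have : 0 ≤ (a - q) ^ 2 * (a + 2 * q) := by positivity
      have e : (a - q) ^ 2 * (a + 2 * q) = a ^ 3 - 3 * q ^ 2 * a + 2 * q ^ 3 := by ring
      rw [e, hq] at this
      have e : q ^ 3 = 2 * q := by rw [← hq]; ring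
      linarith
    have : (sqrt (2 * π))⁻¹ * (a - b ^ 3 - a ^ 3 / 6) ≤ (sqrt (2 * π))⁻¹ * (sqrt 2 - b ^ 3 - sqrt 2 ^ 3 / 6) := by
      gcongr (sqrt (2 * π))⁻¹ * ?_
      linarith
    linarith


lemma aux_flip {n : ℕ} (w : Fin n → ℝ) (i : Fin n) (x : Fin n → Bool)
    (h : |∑ j ∈ univ.erase i, w j * pm (x j)| < |w i|) :
    sgn (∑ j, w j * pm (x j)) ≠ sgn (∑ j, w j * pm (flipAt i x j)) := by
  rw [← add_sum_erase univ (fun j => w j * pm (x j)) (mem_univ i),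
    ← add_sum_erase univ (fun j => w j * pm (flipAt i x j)) (mem_univ i)]
  have e1 : ∑ j ∈ univ.erase i, w j * pm (flipAt i x j) = ∑ j ∈ univ.erase i, w j * pm (x j) := by
    refine sum_congr rfl fun j hj => ?_
    unfold flipAt
    rw [Function.update_of_ne (ne_of_mem_erase hj)]
  have e2 : pm (flipAt i x i) = - pm (x i) := by
    unfold flipAt
    rw [Function.update_self]
    cases x i <;> simp [pm]
  rw [e1, e2]
  have e3 : pm (x i) = 1 ∨ pm (x i) = -1 := by
    cases x i <;> simp [pm]
  generalize ∑ j ∈ univ.erase i, w j * pm (x j) = T at *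
  obtain ⟨h1, h2⟩ := abs_lt.mp h
  unfold sgn
  rcases abs_cases (w i) with ⟨h3, h4⟩ | ⟨h3, h4⟩ <;> rcases e3 with e | e <;> rw [e]
  · rw [if_pos (by linarith), if_neg (by linarith)]; norm_num
  · rw [if_neg (by linarith), if_pos (by linarith)]; norm_num
  · rw [if_neg (by linarith), if_pos (by linarith)]; norm_num
  · rw [if_pos (by linarith), if_neg (by linarith)]; norm_num

lemma aux_infl_lower {n : ℕ} (w : Fin n → ℝ) (i : Fin n) {α σ B b : ℝ} (hα : 0 < α) (hi : α ≤ |w i|) (hσ : 0 < σ)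
    (h2 : ∑ j ∈ univ.erase i, w j ^ 2 = σ ^ 2) (h3 : ∑ j ∈ univ.erase i, |w j| ^ 3 ≤ B) (hb : 0 < b)
    (hbB : b ^ 3 = B / σ ^ 3) :
    (sqrt (2 * π))⁻¹ * (α / σ - b ^ 3 - (α / σ) ^ 3 / 6) - 3.4106 * b ^ 4 ≤
      infl (fun x => sgn (∑ j : Fin n, w j * pm (x j))) i := by
  set u : Fin n → ℝ := fun j => if j = i then 0 else w j / σ with hu
  have hui : u i = 0 := by simp [hu]
  have huj : ∀ j ∈ univ.erase i, u j = w j / σ := fun j hj => by simp [hu, ne_of_mem_erase hj]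
  have s2 : ∑ j, u j ^ 2 = 1 := by
    rw [← add_sum_erase univ _ (mem_univ i), hui, sum_congr rfl (fun j hj => by rw [huj j hj, div_pow]), ← sum_div, h2]
    field_simp
    norm_num
  have s3 : ∑ j, |u j| ^ 3 ≤ b ^ 3 := by
    rw [← add_sum_erase univ _ (mem_univ i), hui, sum_congr rfl (fun j hj => by rw [huj j hj, abs_div, abs_of_pos hσ, div_pow]), ← sum_div, hbB]
    simp only [abs_zero]
    rw [zero_pow (by norm_num), zero_add]
    gcongr
  refine (aux_normalized u hb (by positivity : 0 < α / σ) s2 s3).trans ?_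
  unfold infl
  refine unifPr_mono fun x hx => aux_flip w i x ?_
  have : ∑ j, u j * pm (x j) = (∑ j ∈ univ.erase i, w j * pm (x j)) / σ := by
    rw [← add_sum_erase univ _ (mem_univ i), hui, sum_congr rfl (fun j hj => by rw [huj j hj, div_mul_eq_mul_div]), ← sum_div]
    simp
  rw [this, abs_div, abs_of_pos hσ, div_lt_div_iff_of_pos_right hσ] at hx
  linarith

lemma aux_infl_final {n : ℕ} (hn : 2 ≤ n) (w : Fin n → ℝ)
    (δ : ℝ) (hδ0 : 0 < δ) (hδ1 : δ < 1) (μ : ℝ) (hμ : 0 < μ)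
    (α : ℝ) (hα : α ≥ (1 + 2 * δ / (1 - δ)) * μ) (i : Fin n)
    (hlo : (1 - δ) * ((n : ℝ) - 1) ≤ ∑ j ∈ Finset.univ.erase i, w j ^ 2)
    (hhi : ∑ j ∈ Finset.univ.erase i, w j ^ 2 ≤ (1 + δ) * ((n : ℝ) - 1))
    (hcube : ∑ j ∈ Finset.univ.erase i, |w j| ^ 3 ≤ (1 + δ) * μ * ((n : ℝ) - 1)) (hi : α ≤ |w i|) :
    (α - (1 + 2 * δ / (1 - δ)) * μ) / Real.sqrt (2 * Real.pi * (1 + δ) * ((n : ℝ) - 1))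
        - α ^ 3 / (6 * Real.sqrt (2 * Real.pi) * ((1 - δ) * ((n : ℝ) - 1)) ^ ((3 : ℝ) / 2))
        - 3.4106 * ((1 + δ) * μ) ^ ((4 : ℝ) / 3) / ((1 - δ) ^ 2 * ((n : ℝ) - 1) ^ ((2 : ℝ) / 3)) ≤
      infl (fun x => sgn (∑ j : Fin n, w j * pm (x j))) i := by
  have hM : (0:ℝ) < (n:ℝ) - 1 := by
    have : (2:ℝ) ≤ n := by exact_mod_cast hn
    linarith
  generalize (n:ℝ) - 1 = M at *
  have hd : 0 < 1 - δ := by linarith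
  have hα0 : 0 < α := lt_of_lt_of_le (by positivity) hα
  set V := ∑ j ∈ Finset.univ.erase i, w j ^ 2 with hV
  have hL : 0 < (1 - δ) * M := by positivity
  have hV0 : 0 < V := by linarith
  set σ := sqrt V with hσd
  have hσ : 0 < σ := sqrt_pos.mpr hV0
  have hσ2 : σ ^ 2 = V := sq_sqrt hV0.le
  set b := ((1 + δ) * μ * M / σ ^ 3) ^ ((1:ℝ) / 3) with hbd
  have hb : 0 < b := by positivity
  have hb3 : b ^ 3 = (1 + δ) * μ * M / σ ^ 3 := by
    rw [hbd, ← rpow_natCast, ← rpow_mul (by positivity)]; norm_num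
  have hmain := aux_infl_lower w i hα0 hi hσ (by rw [hσ2]) hcube hb hb3
  refine le_trans ?_ hmain
  have q0 : 1 + 2 * δ / (1 - δ) = (1 + δ) / (1 - δ) := by field_simp; ring
  have q1 : b ^ 3 ≤ (1 + 2 * δ / (1 - δ)) * μ / σ := by
    rw [hb3, q0, div_le_div_iff₀ (by positivity) hσ, show (1 + δ) / (1 - δ) * μ * σ ^ 3 = ((1 + δ) * μ * σ / (1 - δ)) * σ ^ 2 by ring, hσ2]
    calc (1 + δ) * μ * M * σ = ((1 + δ) * μ * σ / (1 - δ)) * ((1 - δ) * M) := by field_simp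
      _ ≤ _ := by gcongr
  have q2 : (α - (1 + 2 * δ / (1 - δ)) * μ) / sqrt (2 * π * (1 + δ) * M) ≤ (sqrt (2 * π))⁻¹ * (α / σ - b ^ 3) := by
    have r1 : sqrt (2 * π * (1 + δ) * M) = sqrt (2 * π) * sqrt ((1 + δ) * M) := by
      rw [mul_assoc, sqrt_mul (by positivity)]
    have r2 : σ ≤ sqrt ((1 + δ) * M) := sqrt_le_sqrt hhi
    have r3 : 0 ≤ α - (1 + 2 * δ / (1 - δ)) * μ := by linarith
    calc _ = (sqrt (2 * π))⁻¹ * ((α - (1 + 2 * δ / (1 - δ)) * μ) / sqrt ((1 + δ) * M)) := by rw [r1]; field_simp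
      _ ≤ (sqrt (2 * π))⁻¹ * ((α - (1 + 2 * δ / (1 - δ)) * μ) / σ) := by gcongr
      _ ≤ _ := by
        gcongr
        rw [sub_div]; linarith
  have hσ3 : ((1 - δ) * M) ^ ((3:ℝ) / 2) ≤ σ ^ 3 := by
    have : σ ^ 3 = V ^ ((3:ℝ) / 2) := by
      rw [hσd, sqrt_eq_rpow, ← rpow_natCast, ← rpow_mul hV0.le]; norm_num
    rw [this]
    gcongr
  have q3 : (sqrt (2 * π))⁻¹ * ((α / σ) ^ 3 / 6) ≤ α ^ 3 / (6 * sqrt (2 * π) * ((1 - δ) * M) ^ ((3 : ℝ) / 2)) := by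
    calc _ = α ^ 3 / (6 * sqrt (2 * π) * σ ^ 3) := by field_simp
      _ ≤ _ := by gcongr
  have q4 : b ^ 4 ≤ ((1 + δ) * μ) ^ ((4 : ℝ) / 3) / ((1 - δ) ^ 2 * M ^ ((2 : ℝ) / 3)) := by
    have r1 : b ^ 4 = ((1 + δ) * μ * M / σ ^ 3) ^ ((4:ℝ) / 3) := by
      rw [hbd, ← rpow_natCast, ← rpow_mul (by positivity)]; norm_num
    rw [r1]
    calc ((1 + δ) * μ * M / σ ^ 3) ^ ((4:ℝ) / 3) ≤ ((1 + δ) * μ * M / ((1 - δ) * M) ^ ((3:ℝ) / 2)) ^ ((4:ℝ) / 3) := by gcongr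
      _ = _ := by
        rw [div_rpow (by positivity) (by positivity), mul_rpow (by positivity) hM.le, ← rpow_mul hL.le]
        rw [show (3:ℝ) / 2 * (4 / 3) = (2:ℕ) by norm_num, rpow_natCast, mul_pow]
        rw [div_eq_div_iff (by positivity) (by positivity)]
        have : M ^ ((4:ℝ) / 3) * M ^ ((2:ℝ) / 3) = M ^ 2 := by
          rw [← rpow_add hM, ← rpow_natCast]; norm_num
        rw [← this]; ring
  have q5 := mul_le_mul_of_nonneg_left q4 (by norm_num : (0:ℝ) ≤ 3.4106)
  rw [← mul_div_assoc] at q5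
  rw [mul_sub]
  linarith

/-- total influence lower bound for a regular homogeneous LTF with
at least m large weights. -/
theorem total_influence_regular_lower_bound (n : ℕ) (hn : 2 ≤ n) (w : Fin n → ℝ)
    (δ : ℝ) (hδ0 : 0 < δ) (hδ1 : δ < 1) (μ : ℝ) (hμ : 0 < μ)
    (α : ℝ) (hα : α ≥ (1 + 2 * δ / (1 - δ)) * μ)
    (hsq_lo : ∀ i : Fin n, (1 - δ) * ((n : ℝ) - 1) ≤ ∑ j ∈ Finset.univ.erase i, w j ^ 2)
    (hsq_hi : ∀ i : Fin n, ∑ j ∈ Finset.univ.erase i, w j ^ 2 ≤ (1 + δ) * ((n : ℝ) - 1))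
    (hcube : ∀ i : Fin n, ∑ j ∈ Finset.univ.erase i, |w j| ^ 3 ≤ (1 + δ) * μ * ((n : ℝ) - 1))
    (m : ℕ) (hm : m ≤ (Finset.univ.filter (fun i : Fin n => α ≤ |w i|)).card) :
    totalInfl (fun x => sgn (∑ j : Fin n, w j * pm (x j))) ≥
      (m : ℝ) * ((α - (1 + 2 * δ / (1 - δ)) * μ) / Real.sqrt (2 * Real.pi * (1 + δ) * ((n : ℝ) - 1))
        - α ^ 3 / (6 * Real.sqrt (2 * Real.pi) * ((1 - δ) * ((n : ℝ) - 1)) ^ ((3 : ℝ) / 2))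
        - 3.4106 * ((1 + δ) * μ) ^ ((4 : ℝ) / 3) / ((1 - δ) ^ 2 * ((n : ℝ) - 1) ^ ((2 : ℝ) / 3))) := by
  have key := fun i => aux_infl_final hn w δ hδ0 hδ1 μ hμ α hα i (hsq_lo i) (hsq_hi i) (hcube i)
  generalize (α - (1 + 2 * δ / (1 - δ)) * μ) / Real.sqrt (2 * Real.pi * (1 + δ) * ((n : ℝ) - 1))
        - α ^ 3 / (6 * Real.sqrt (2 * Real.pi) * ((1 - δ) * ((n : ℝ) - 1)) ^ ((3 : ℝ) / 2))
        - 3.4106 * ((1 + δ) * μ) ^ ((4 : ℝ) / 3) / ((1 - δ) ^ 2 * ((n : ℝ) - 1) ^ ((2 : ℝ) / 3)) = Q at *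
  have hnn : ∀ i, 0 ≤ infl (fun x => sgn (∑ j : Fin n, w j * pm (x j))) i := fun i => unifPr_nonneg _
  unfold totalInfl
  rcases le_total Q 0 with hQ | hQ
  · have h1 : (m:ℝ) * Q ≤ 0 := mul_nonpos_of_nonneg_of_nonpos (by positivity) hQ
    have h2 := sum_nonneg (s := univ) fun i _ => hnn i
    linarith
  · have h1 : ∑ i ∈ Finset.univ.filter (fun i : Fin n => α ≤ |w i|), Q ≤ ∑ i, infl (fun x => sgn (∑ j : Fin n, w j * pm (x j))) i := by
      refine le_trans (sum_le_sum fun i hi => key i (mem_filter.mp hi).2) ?_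
      exact sum_le_sum_of_subset_of_nonneg (filter_subset _ _) fun i _ _ => hnn i
    rw [sum_const, nsmul_eq_mul] at h1
    have h2 : (m:ℝ) * Q ≤ ((Finset.univ.filter (fun i : Fin n => α ≤ |w i|)).card : ℝ) * Q := by gcongr
    linarith
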